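/- Let B be a noetherian scheme, let S be a finite type B-scheme, and let X and Y be finite type S-schemes. Then there exists a countable family {S_i → S}_{i∈I} of finite type S-schemes such that: (1) for each i, the base changes X ×_S S_i and Y ×_S S_i are isomorphic as S_i-schemes; and (2) for every section s : B → S of the structure morphism S → B such that the fibers X_s := X ×_{S,s} B and Y_s := Y ×_{S,s} B are isomorphic as B-schemes, the morphism s : B → S factors through one of the morphisms S_i → S. -/

import Mathlib

open AlgebraicGeometry CategoryTheory Limits

universe u

namespace CDF

/-- Schemes of finite type over `ℤ`. -/
structure FTZ (T : Scheme.{u}) : Prop where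
  loft : LocallyOfFiniteType (specULiftZIsTerminal.from T)
  compact : CompactSpace T

lemma FTZ.of_hom {T T' : Scheme.{u}} (h : T' ⟶ T) [LocallyOfFiniteType h] [QuasiCompact h]
    (hT : FTZ T) : FTZ T' := by
  have := hT.loft
  have := hT.compact
  refine ⟨?_, QuasiCompact.compactSpace_of_compactSpace h⟩
  rw [specULiftZIsTerminal.hom_ext (specULiftZIsTerminal.from T')
    (h ≫ specULiftZIsTerminal.from T)]
  infer_instance

lemma FTZ.noeth {T : Scheme.{u}} (hT : FTZ T) : IsNoetherian T := by
  have := hT.loft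
  have := hT.compact
  have : IsNoetherianRing (ULift.{u} ℤ) :=
    isNoetherianRing_of_ringEquiv ℤ ULift.ringEquiv.symm
  have : IsLocallyNoetherian T :=
    LocallyOfFiniteType.isLocallyNoetherian (specULiftZIsTerminal.from T)
  exact {}

lemma FTZ.hom {T : Scheme.{u}} (hT : FTZ T) {T' : Scheme.{u}} (h : T ⟶ T') :
    LocallyOfFiniteType h := by
  have := hT.loft
  have : LocallyOfFiniteType (h ≫ specULiftZIsTerminal.from T') := by
    rwa [← specULiftZIsTerminal.hom_ext (specULiftZIsTerminal.from T)
      (h ≫ specULiftZIsTerminal.from T')]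
  exact locallyOfFiniteType_of_comp h (specULiftZIsTerminal.from T')

lemma FTZ.qc {T : Scheme.{u}} (hT : FTZ T) {T' : Scheme.{u}} (h : T ⟶ T') :
    QuasiCompact h := by
  have := hT.noeth
  infer_instance

lemma FTZ.finiteType {T : Scheme.{u}} (hT : FTZ T) {U : T.Opens} (hU : IsAffineOpen U) :
    Algebra.FiniteType ℤ Γ(T, U) := by
  have := hT.loft
  have h := LocallyOfFiniteType.finiteType_appLE (specULiftZIsTerminal.from T)
    (isAffineOpen_top _) hU le_top
  have e : (algebraMap ℤ Γ(T, U)).FiniteType := by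
    let e1 : ULift.{u} ℤ ≃+* Γ(Spec (.of (ULift.{u} ℤ)), ⊤) :=
      (Scheme.ΓSpecIso (.of (ULift.{u} ℤ))).symm.commRingCatIsoToRingEquiv
    have h2 := (h.comp (RingHom.FiniteType.of_surjective _ e1.surjective)).comp
      (RingHom.FiniteType.of_surjective (ULift.ringEquiv.{0, u} (R := ℤ)).symm.toRingHom
        (ULift.ringEquiv.{0, u} (R := ℤ)).symm.surjective)
    convert h2
    exact Subsingleton.elim _ _
  exact (RingHom.finiteType_algebraMap).mp e

lemma FTZ.spec (R : CommRingCat.{u}) [h : Algebra.FiniteType ℤ R] : FTZ (Spec R) := by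
  refine ⟨?_, inferInstance⟩
  let φ : CommRingCat.of (ULift.{u} ℤ) ⟶ R :=
    CommRingCat.ofHom ((algebraMap ℤ R).comp (ULift.ringEquiv.{0, u} (R := ℤ)).toRingHom)
  rw [specULiftZIsTerminal.hom_ext (specULiftZIsTerminal.from (Spec R)) (Spec.map φ)]
  rw [HasRingHomProperty.Spec_iff (P := @LocallyOfFiniteType)]
  exact (RingHom.finiteType_algebraMap.mpr h).comp
    (RingHom.FiniteType.of_surjective _ (ULift.ringEquiv.{0, u} (R := ℤ)).surjective)

lemma FTZ.of_cover {T : Scheme.{u}} (𝒰 : T.OpenCover) [Finite 𝒰.I₀] (h : ∀ i, FTZ (𝒰.X i)) :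
    FTZ T := by
  constructor
  · have : IsZariskiLocalAtSource @LocallyOfFiniteType :=
      HasRingHomProperty.instIsZariskiLocalAtSource (Q := RingHom.FiniteType)
    rw [IsZariskiLocalAtSource.iff_of_openCover (P := @LocallyOfFiniteType) 𝒰]
    intro i
    exact (h i).hom _
  · have : ∀ i, CompactSpace (𝒰.X i) := fun i ↦ (h i).compact
    exact 𝒰.compactSpace

lemma FTZ.opens {T : Scheme.{u}} (hT : FTZ T) (U : T.Opens) : FTZ U := by
  have := hT.noeth
  exact hT.of_hom U.ι

lemma FTZ.of_isIso {T T' : Scheme.{u}} (h : T' ⟶ T) [IsIso h] (hT : FTZ T) : FTZ T' :=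
  hT.of_hom h

lemma FTZ.lofp {T : Scheme.{u}} {T' : Scheme.{u}} (hT' : FTZ T') (h : T ⟶ T')
    [LocallyOfFiniteType h] : LocallyOfFinitePresentation h := by
  have := hT'.noeth
  exact LocallyOfFinitePresentation.iff_locallyOfFiniteType.mpr inferInstance

/-! ### Gluing two schemes -/

/-- A two-element open cover. -/
noncomputable def cover2 {T U V : Scheme.{u}} (i : U ⟶ T) (j : V ⟶ T) [IsOpenImmersion i]
    [IsOpenImmersion j] (h : i.opensRange ⊔ j.opensRange = ⊤) : T.OpenCover :=
  Scheme.Cover.mkOfCovers Bool (fun b ↦ bif b then U else V)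
    (fun b ↦ match b with
      | true => i
      | false => j)
    (fun x ↦ by
      have : x ∈ i.opensRange ⊔ j.opensRange := by rw [h]; trivial
      rcases this with ⟨y, hy⟩ | ⟨y, hy⟩
      · exact ⟨true, y, hy⟩
      · exact ⟨false, y, hy⟩)
    (fun b ↦ by cases b <;> (dsimp; infer_instance))

lemma hom_ext2 {T U V Z : Scheme.{u}} (i : U ⟶ T) (j : V ⟶ T) [IsOpenImmersion i]
    [IsOpenImmersion j] (h : i.opensRange ⊔ j.opensRange = ⊤) (f g : T ⟶ Z)
    (h1 : i ≫ f = i ≫ g) (h2 : j ≫ f = j ≫ g) : f = g := by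
  refine (cover2 i j h).hom_ext _ _ ?_
  rintro (_ | _)
  · exact h2
  · exact h1

lemma glue2 {T U V W Z : Scheme.{u}} (i : U ⟶ T) (j : V ⟶ T) [IsOpenImmersion i]
    [IsOpenImmersion j] (h : i.opensRange ⊔ j.opensRange = ⊤) {a : W ⟶ U} {b : W ⟶ V}
    (hp : IsPullback a b i j) (f : U ⟶ Z) (g : V ⟶ Z) (w : a ≫ f = b ≫ g) :
    ∃ m : T ⟶ Z, i ≫ m = f ∧ j ≫ m = g := by
  let 𝒰 := cover2 i j h
  let F : ∀ b : 𝒰.I₀, 𝒰.X b ⟶ Z := fun b ↦ match b with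
    | true => f
    | false => g
  have key : pullback.fst i j ≫ f = pullback.snd i j ≫ g := by
    rw [← hp.isoPullback_inv_fst, ← hp.isoPullback_inv_snd, Category.assoc, w, Category.assoc]
  have hF : ∀ x y, pullback.fst (𝒰.f x) (𝒰.f y) ≫ F x = pullback.snd (𝒰.f x) (𝒰.f y) ≫ F y := by
    rintro (_ | _) (_ | _)
    · have : pullback.fst j j = pullback.snd j j := by
        rw [← cancel_mono j, pullback.condition]
      exact congrArg (· ≫ g) this
    · have := pullbackSymmetry_hom_comp_fst j i
      have h2 := pullbackSymmetry_hom_comp_snd j i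
      change pullback.fst j i ≫ g = pullback.snd j i ≫ f
      rw [← this, ← h2, Category.assoc, Category.assoc, key]
    · exact key
    · have : pullback.fst i i = pullback.snd i i := by
        rw [← cancel_mono i, pullback.condition]
      exact congrArg (· ≫ f) this
  exact ⟨𝒰.glueMorphisms F hF, 𝒰.ι_glueMorphisms F hF true, 𝒰.ι_glueMorphisms F hF false⟩

/-- Pushouts of open immersions. -/
lemma exists_glue {U V W : Scheme.{u}} (a : W ⟶ U) (b : W ⟶ V) [IsOpenImmersion a]
    [IsOpenImmersion b] : ∃ (T : Scheme.{u}) (i : U ⟶ T) (j : V ⟶ T)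
      (_ : IsOpenImmersion i) (_ : IsOpenImmersion j), i.opensRange ⊔ j.opensRange = ⊤ ∧
      IsPullback a b i j := by
  let F := span a b
  have e1 : IsOpenImmersion (pushout.inl a b) :=
    inferInstanceAs (IsOpenImmersion (colimit.ι F WalkingSpan.left))
  have e2 : IsOpenImmersion (pushout.inr a b) :=
    inferInstanceAs (IsOpenImmersion (colimit.ι F WalkingSpan.right))
  refine ⟨pushout a b, pushout.inl a b, pushout.inr a b, e1, e2, ?_, ?_⟩
  · rw [eq_top_iff]
    rintro x -
    obtain ⟨k, y, hy⟩ := Scheme.IsLocallyDirected.ι_jointly_surjective F x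
    rcases k with _ | _ | _
    · left
      have hw : a ≫ pushout.inl a b = (colimit.ι F WalkingSpan.zero : W ⟶ pushout a b) :=
        colimit.w F WalkingSpan.Hom.fst
      exact ⟨(a : W ⟶ U) (y : W),
        (congrArg (fun m : W ⟶ pushout a b ↦ m (y : W)) hw).trans hy⟩
    · exact Or.inl ⟨y, hy⟩
    · exact Or.inr ⟨y, hy⟩
  · refine IsOpenImmersion.isPullback _ _ _ _ pushout.condition.symm ?_
    ext x
    constructor
    · rintro ⟨y, hy⟩
      obtain ⟨k, f, g, z, hf, hg⟩ := (Scheme.IsLocallyDirected.ι_eq_ι_iff F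
        (i := WalkingSpan.left) (j := WalkingSpan.right)).mp hy
      rcases k with _ | _ | _
      · refine ⟨z, ?_⟩
        obtain rfl : g = WalkingSpan.Hom.snd := Subsingleton.elim _ _
        exact hg
      · rcases g with _ | _
      · rcases f with _ | _
    · rintro ⟨w, rfl⟩
      refine ⟨a w, ?_⟩
      rw [← Scheme.Hom.comp_apply, ← Scheme.Hom.comp_apply, pushout.condition]

end CDF

namespace CDF

lemma exists_pt {P X Y Z : Scheme.{u}} {a : P ⟶ X} {b : P ⟶ Y} {f : X ⟶ Z} {g : Y ⟶ Z}
    (h : IsPullback a b f g) (x : X) (y : Y) (e : f x = g y) : ∃ p, a p = x ∧ b p = y := by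
  obtain ⟨z, h1, h2⟩ := Scheme.Pullback.exists_preimage_pullback x y e
  refine ⟨h.isoPullback.inv z, ?_, ?_⟩
  · rw [← Scheme.Hom.comp_apply, h.isoPullback_inv_fst, h1]
  · rw [← Scheme.Hom.comp_apply, h.isoPullback_inv_snd, h2]

lemma local2 (P : MorphismProperty Scheme.{u}) [IsZariskiLocalAtTarget P]
    {T U V B U' V' : Scheme.{u}} (i : U ⟶ T) (j : V ⟶ T)
    [IsOpenImmersion i] [IsOpenImmersion j] (h : i.opensRange ⊔ j.opensRange = ⊤)
    (m : B ⟶ T) {a : U' ⟶ U} {a' : U' ⟶ B} {b : V' ⟶ V} {b' : V' ⟶ B}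
    (hU : IsPullback a a' i m) (hV : IsPullback b b' j m) (h1 : P a) (h2 : P b) : P m := by
  refine IsZariskiLocalAtTarget.of_openCover (cover2 i j h) ?_
  have aux : ∀ {U U' : Scheme.{u}} (i : U ⟶ T) {a : U' ⟶ U} {a' : U' ⟶ B}
      (hU : IsPullback a a' i m), P a → P (pullback.snd m i) := by
    intro U U' i a a' hU ha
    rw [← hU.flip.isoPullback_inv_snd]
    exact (P.cancel_left_of_respectsIso _ _).mpr ha
  rintro (_ | _)
  · exact aux j hV h2
  · exact aux i hU h1

lemma glue_map {B U V W T TU V0 W0 : Scheme.{u}} (i : U ⟶ B) (j : V ⟶ B)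
    [IsOpenImmersion i] [IsOpenImmersion j] (h : i.opensRange ⊔ j.opensRange = ⊤)
    {a : W ⟶ U} {b : W ⟶ V} (hp : IsPullback a b i j)
    (i0 : TU ⟶ T) (j0 : V0 ⟶ T) [IsOpenImmersion i0] [IsOpenImmersion j0]
    {a0 : W0 ⟶ TU} {b0 : W0 ⟶ V0} (hp0 : IsPullback a0 b0 i0 j0)
    (hU : U ⟶ TU) (hV : V ⟶ V0) (hW : W ⟶ W0)
    (pU : IsPullback hW a a0 hU) (pV : IsPullback hW b b0 hV) :
    ∃ m : B ⟶ T, IsPullback hU i i0 m ∧ IsPullback hV j j0 m := by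
  obtain ⟨m, h1, h2⟩ := glue2 i j h hp (hU ≫ i0) (hV ≫ j0) (by
    rw [← reassoc_of% pU.w, ← reassoc_of% pV.w, hp0.w])
  have cov : ∀ x : B, (∃ y, i y = x) ∨ ∃ y, j y = x := by
    intro x
    have : x ∈ i.opensRange ⊔ j.opensRange := by rw [h]; trivial
    exact this
  refine ⟨m, ?_, ?_⟩
  · refine IsOpenImmersion.isPullback _ _ _ _ h1 ?_
    ext x
    constructor
    · rintro ⟨t, ht⟩
      rcases cov x with hx | ⟨v, rfl⟩
      · exact hx
      · rw [← Scheme.Hom.comp_apply, h2, Scheme.Hom.comp_apply] at ht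
        obtain ⟨w0, -, hw0⟩ := exists_pt hp0 _ _ ht
        obtain ⟨w, -, rfl⟩ := exists_pt pV _ _ hw0
        refine ⟨a w, ?_⟩
        rw [← Scheme.Hom.comp_apply, hp.w, Scheme.Hom.comp_apply]
    · rintro ⟨u, rfl⟩
      refine ⟨hU u, ?_⟩
      rw [← Scheme.Hom.comp_apply, ← Scheme.Hom.comp_apply, h1]
  · refine IsOpenImmersion.isPullback _ _ _ _ h2 ?_
    ext x
    constructor
    · rintro ⟨t, ht⟩
      rcases cov x with ⟨v, rfl⟩ | hx
      · rw [← Scheme.Hom.comp_apply, h1, Scheme.Hom.comp_apply] at ht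
        obtain ⟨w0, hw0, -⟩ := exists_pt hp0 _ _ ht.symm
        obtain ⟨w, -, rfl⟩ := exists_pt pU _ _ hw0
        refine ⟨b w, ?_⟩
        rw [← Scheme.Hom.comp_apply, ← hp.w, Scheme.Hom.comp_apply]
      · exact hx
    · rintro ⟨u, rfl⟩
      refine ⟨hV u, ?_⟩
      rw [← Scheme.Hom.comp_apply, ← Scheme.Hom.comp_apply, h2]

/-- Being a pullback can be checked on two opens covering the upper right corner. -/
lemma isPullback_glue {X P B D U V PU PV : Scheme.{u}} (i : PU ⟶ P) (j : PV ⟶ P)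
    [IsOpenImmersion i] [IsOpenImmersion j] (h : i.opensRange ⊔ j.opensRange = ⊤)
    {g : X ⟶ P} {x : X ⟶ B} {p : P ⟶ D} {c : B ⟶ D} (w : g ≫ p = x ≫ c)
    {gU : U ⟶ PU} {iU : U ⟶ X} {gV : V ⟶ PV} {iV : V ⟶ X}
    (sU : IsPullback gU iU i g) (sV : IsPullback gV iV j g)
    (tU : IsPullback gU (iU ≫ x) (i ≫ p) c) (tV : IsPullback gV (iV ≫ x) (j ≫ p) c) :
    IsPullback g x p c := by
  obtain ⟨m, hm1, hm2⟩ : ∃ m : X ⟶ pullback p c, m ≫ pullback.fst p c = g ∧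
      m ≫ pullback.snd p c = x := ⟨pullback.lift g x w, pullback.lift_fst _ _ _,
        pullback.lift_snd _ _ _⟩
  have key : ∀ {U PU : Scheme.{u}} (i : PU ⟶ P) {gU : U ⟶ PU} {iU : U ⟶ X}
      (_ : IsPullback gU iU i g) (_ : IsPullback gU (iU ≫ x) (i ≫ p) c),
      ∃ (e : U ⟶ pullback i (pullback.fst p c)), IsIso e ∧
        IsPullback e iU (pullback.snd i (pullback.fst p c)) m := by
    intro U PU i gU iU s t
    obtain ⟨e, he1, he2⟩ : ∃ e : U ⟶ pullback i (pullback.fst p c),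
        e ≫ pullback.fst _ _ = gU ∧ e ≫ pullback.snd _ _ = iU ≫ m :=
      ⟨pullback.lift gU (iU ≫ m) (by rw [Category.assoc, hm1, s.w]), pullback.lift_fst _ _ _,
        pullback.lift_snd _ _ _⟩
    have t' : IsPullback (pullback.fst i (pullback.fst p c))
        (pullback.snd i (pullback.fst p c) ≫ pullback.snd p c) (i ≫ p) c :=
      (IsPullback.paste_horiz (IsPullback.of_hasPullback i (pullback.fst p c)).flip
        (IsPullback.of_hasPullback p c).flip).flip
    refine ⟨e, ?_, ?_⟩
    · have : e = (t.isoIsPullback _ _ t').hom := by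
        refine t'.hom_ext ?_ ?_
        · rw [he1, IsPullback.isoIsPullback_hom_fst]
        · rw [reassoc_of% he2, hm2, IsPullback.isoIsPullback_hom_snd]
      rw [this]
      infer_instance
    · have h1 : IsPullback (e ≫ pullback.fst i (pullback.fst p c)) iU i
          (m ≫ pullback.fst p c) := by
        rw [he1, hm1]
        exact s
      exact IsPullback.of_right h1 he2 (IsPullback.of_hasPullback i (pullback.fst p c))
  obtain ⟨eU, hU, pU⟩ := key i sU tU
  obtain ⟨eV, hV, pV⟩ := key j sV tV
  have hm : IsIso m := by
    refine local2 (MorphismProperty.isomorphisms Scheme.{u}) (pullback.snd i (pullback.fst p c))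
      (pullback.snd j (pullback.fst p c)) ?_ m pU pV hU hV
    rw [eq_top_iff]
    rintro z -
    have : pullback.fst p c z ∈ i.opensRange ⊔ j.opensRange := by rw [h]; trivial
    rcases this with ⟨y, hy⟩ | ⟨y, hy⟩
    · obtain ⟨q, -, hq⟩ := exists_pt (IsPullback.of_hasPullback i (pullback.fst p c)) y z hy
      exact Or.inl ⟨q, hq⟩
    · obtain ⟨q, -, hq⟩ := exists_pt (IsPullback.of_hasPullback j (pullback.fst p c)) y z hy
      exact Or.inr ⟨q, hq⟩
  exact IsPullback.of_iso_pullback ⟨w⟩ (asIso m) hm1 hm2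

end CDF

namespace CDF

lemma exists_subalgebra {A₀ P ι : Type*} [CommRing A₀] [CommRing P] [Algebra A₀ P] [Finite ι]
    (r : ι → P) (Q : ι → Type*) [∀ l, CommRing (Q l)] [∀ l, Algebra A₀ (Q l)]
    (φ : ∀ l, P →ₐ[A₀] Q l)
    (hφ : ∀ l, @IsLocalization.Away P _ (r l) (Q l) _ (φ l).toRingHom.toAlgebra)
    [∀ l, Algebra.FiniteType A₀ (Q l)] (E : Set P) (hE : E.Finite) :
    ∃ R : Subalgebra A₀ P, R.FG ∧ E ⊆ R ∧ ∃ hr : ∀ l, r l ∈ R, ∀ l,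
      @IsLocalization.Away R _ ⟨r l, hr l⟩ (Q l) _
        ((φ l).toRingHom.comp R.val.toRingHom).toAlgebra := by
  classical
  choose s hs using fun l ↦ (Algebra.FiniteType.out : (⊤ : Subalgebra A₀ (Q l)).FG)
  have h1 : ∀ l (b : Q l), ∃ (p : P) (n : ℕ), b * φ l (r l) ^ n = φ l p := by
    intro l b
    let _ := (φ l).toRingHom.toAlgebra
    have := hφ l
    obtain ⟨n, a, h⟩ := IsLocalization.Away.surj (r l) b
    exact ⟨a, n, h⟩
  choose p n hp using h1
  have _ := Fintype.ofFinite ι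
  let F : Set P := E ∪ Set.range r ∪ ⋃ l, (p l) '' (s l)
  have hF : F.Finite := (hE.union (Set.finite_range r)).union
    (Set.finite_iUnion fun l ↦ (s l).finite_toSet.image _)
  let R := Algebra.adjoin A₀ F
  have hFR : F ⊆ R := Algebra.subset_adjoin
  have hr : ∀ l, r l ∈ R := fun l ↦ hFR (Or.inl (Or.inr ⟨l, rfl⟩))
  refine ⟨R, ⟨hF.toFinset, by simp [R]⟩, fun x hx ↦ hFR (Or.inl (Or.inl hx)), hr, ?_⟩
  intro l
  let a1 := (φ l).toRingHom.toAlgebra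
  have hl : IsLocalization.Away (r l) (Q l) := hφ l
  let a2 := ((φ l).toRingHom.comp R.val.toRingHom).toAlgebra
  have key : ∀ b : Q l, ∃ (n : ℕ) (a : R), b * φ l (r l) ^ n = φ l a := by
    intro b
    have hb : b ∈ Algebra.adjoin A₀ (s l : Set (Q l)) := by rw [hs]; trivial
    induction hb using Algebra.adjoin_induction with
    | mem x hx =>
      exact ⟨n l x, ⟨p l x, hFR (Or.inr (Set.mem_iUnion.mpr ⟨l, x, hx, rfl⟩))⟩, hp l x⟩
    | algebraMap a =>
      exact ⟨0, algebraMap A₀ R a, by simp⟩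
    | add x y _ _ hx hy =>
      obtain ⟨m, a, ha⟩ := hx
      obtain ⟨m', a', ha'⟩ := hy
      refine ⟨m + m', a * ⟨r l, hr l⟩ ^ m' + a' * ⟨r l, hr l⟩ ^ m, ?_⟩
      simp only [Subalgebra.coe_add, Subalgebra.coe_mul, Subalgebra.coe_pow, map_add, map_mul,
        map_pow, ← ha, ← ha']
      ring
    | mul x y _ _ hx hy =>
      obtain ⟨m, a, ha⟩ := hx
      obtain ⟨m', a', ha'⟩ := hy
      refine ⟨m + m', a * a', ?_⟩
      simp only [Subalgebra.coe_mul, map_mul, ← ha, ← ha']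
      ring
  refine (IsLocalization.Away.mk (⟨r l, hr l⟩ : R) ?_ ?_ ?_)
  · exact IsLocalization.Away.algebraMap_isUnit (S := Q l) (r l)
  · intro b
    obtain ⟨m, a, h⟩ := key b
    exact ⟨m, a, h⟩
  · intro a b hab
    obtain ⟨m, h⟩ := IsLocalization.Away.exists_of_eq (S := Q l) (r l) (a := a.1) (b := b.1) hab
    exact ⟨m, Subtype.ext h⟩


lemma fiberProd_loc {A₀ A Q G L : Type*} [CommRing A₀] [CommRing A] [CommRing Q] [CommRing G]
    [CommRing L] [Algebra A₀ A] [Algebra A₀ Q] [Algebra A₀ G] [Algebra A₀ L]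
    (ρ : A →ₐ[A₀] G) (σ : Q →ₐ[A₀] G) (τ : Q →ₐ[A₀] L) (q : Q) (g : A) (h : σ q = ρ g)
    (hL : @IsLocalization.Away Q _ q L _ τ.toRingHom.toAlgebra)
    (h1 : ∀ x : G, ∃ (n : ℕ) (a : A), ρ g ^ n * x = ρ a)
    (h2 : ∀ a : A, ρ a = 0 → ∃ n : ℕ, g ^ n * a = 0) :
    @IsLocalization.Away (AlgHom.equalizer (σ.comp (AlgHom.fst A₀ Q A))
        (ρ.comp (AlgHom.snd A₀ Q A))) _
      ⟨(q, g), h⟩ L _ ((τ.comp (AlgHom.fst A₀ Q A)).comp (AlgHom.equalizer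
        (σ.comp (AlgHom.fst A₀ Q A)) (ρ.comp (AlgHom.snd A₀ Q A))).val).toRingHom.toAlgebra := by
  let a1 := τ.toRingHom.toAlgebra
  let a2 := ((τ.comp (AlgHom.fst A₀ Q A)).comp (AlgHom.equalizer
        (σ.comp (AlgHom.fst A₀ Q A)) (ρ.comp (AlgHom.snd A₀ Q A))).val).toRingHom.toAlgebra
  refine IsLocalization.Away.mk _ ?_ ?_ ?_
  · exact IsLocalization.Away.algebraMap_isUnit (S := L) q
  · intro b
    obtain ⟨n, c, hc⟩ := IsLocalization.Away.surj q b
    obtain ⟨m, a, ha⟩ := h1 (σ c)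
    have hc' : b * τ q ^ n = τ c := hc
    refine ⟨n + m, ⟨(q ^ m * c, a), ?_⟩, ?_⟩
    · change σ (q ^ m * c) = ρ a
      rw [map_mul, map_pow, h, ha]
    · change b * τ q ^ (n + m) = τ (q ^ m * c)
      rw [map_mul, ← hc', map_pow]
      ring
  · rintro ⟨⟨c, a⟩, hca⟩ ⟨⟨c', a'⟩, hca'⟩ e
    obtain ⟨n, hn⟩ := IsLocalization.Away.exists_of_eq (S := L) q (a := c) (b := c') e
    replace hca : σ c = ρ a := hca
    replace hca' : σ c' = ρ a' := hca'
    obtain ⟨m, hm⟩ := h2 (g ^ n * (a - a')) (by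
      rw [map_mul, map_sub, ← hca, ← hca', ← map_sub, map_pow, ← h, ← map_pow, ← map_mul, mul_sub,
        hn, sub_self, map_zero])
    refine ⟨m + n, Subtype.ext (Prod.ext ?_ ?_)⟩
    · change q ^ (m + n) * c = q ^ (m + n) * c'
      rw [pow_add, mul_assoc, hn, mul_assoc]
    · change g ^ (m + n) * a = g ^ (m + n) * a'
      rw [← sub_eq_zero, ← mul_sub, pow_add, mul_assoc, hm]

lemma isOpenImmersion_of_cover {W T : Scheme.{u}} (θ : W ⟶ T) {ι : Type*} (O : ι → T.Opens)
    (Y : ι → Scheme.{u}) (i : ∀ l, Y l ⟶ W) [∀ l, IsOpenImmersion (i l)]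
    (hi : ∀ l, (i l).opensRange = θ ⁻¹ᵁ O l)
    (h : ⨆ l, θ ⁻¹ᵁ (O l) = ⊤) (hO : ∀ l, IsOpenImmersion (i l ≫ θ)) : IsOpenImmersion θ := by
  have cov : ∀ x : W, ∃ l, x ∈ θ ⁻¹ᵁ O l := by
    intro x
    have : x ∈ ⨆ l, θ ⁻¹ᵁ (O l) := by rw [h]; trivial
    simpa using this
  apply IsOpenImmersion.of_forall_source_exists
  · intro x y hxy
    obtain ⟨l, hl⟩ := cov x
    have hl' : y ∈ θ ⁻¹ᵁ O l := by
      change θ y ∈ O l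
      rw [← hxy]
      exact hl
    rw [← hi] at hl hl'
    obtain ⟨x, rfl⟩ := hl
    obtain ⟨y, rfl⟩ := hl'
    rw [← Scheme.Hom.comp_apply, ← Scheme.Hom.comp_apply] at hxy
    rw [(i l ≫ θ).isOpenEmbedding.injective hxy]
  · intro x
    obtain ⟨l, hl⟩ := cov x
    exact ⟨_, i l, inferInstance, by rwa [hi], hO l⟩

/-- The morphism to an affine scheme associated with a ring homomorphism. -/
noncomputable def toS {X : Scheme.{u}} {R : CommRingCat.{u}} (φ : R ⟶ Γ(X, ⊤)) : X ⟶ Spec R :=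
  X.toSpecΓ ≫ Spec.map φ

lemma comp_toS {X Y : Scheme.{u}} {R : CommRingCat.{u}} (f : Y ⟶ X) (φ : R ⟶ Γ(X, ⊤)) :
    f ≫ toS φ = toS (φ ≫ f.appTop) := by
  simp [toS, Scheme.toSpecΓ_naturality_assoc]

lemma toS_comp {X : Scheme.{u}} {R R' : CommRingCat.{u}} (φ : R ⟶ Γ(X, ⊤)) (ψ : R' ⟶ R) :
    toS φ ≫ Spec.map ψ = toS (ψ ≫ φ) := by
  simp [toS]

lemma exists_toS {X : Scheme.{u}} {R : CommRingCat.{u}} (f : X ⟶ Spec R) :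
    ∃ φ : R ⟶ Γ(X, ⊤), f = toS φ := by
  refine ⟨(Scheme.ΓSpecIso R).inv ≫ f.appTop, ?_⟩
  rw [← comp_toS]
  simp [toS]

lemma toS_appTop {X : Scheme.{u}} {R : CommRingCat.{u}} (φ : R ⟶ Γ(X, ⊤)) :
    (toS φ).appTop = (Scheme.ΓSpecIso R).hom ≫ φ := by
  simp [toS]

lemma toS_inj {X : Scheme.{u}} {R : CommRingCat.{u}} {φ ψ : R ⟶ Γ(X, ⊤)} (h : toS φ = toS ψ) :
    φ = ψ := by
  have := congrArg (fun f ↦ (Scheme.ΓSpecIso R).inv ≫ f.appTop) h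
  simpa [toS_appTop] using this

lemma toS_preimage {X : Scheme.{u}} {R : CommRingCat.{u}} (φ : R ⟶ Γ(X, ⊤)) (r : R) :
    toS φ ⁻¹ᵁ (PrimeSpectrum.basicOpen r) = X.basicOpen (φ r) := by
  rw [← basicOpen_eq_of_affine, Scheme.preimage_basicOpen]
  congr 1
  change (toS φ).appTop _ = _
  rw [toS_appTop]
  simp


lemma toS_loc {X : Scheme.{u}} {R : CommRingCat.{u}} (φ : R ⟶ Γ(X, ⊤)) (r : R)
    (hX : IsAffineOpen (X.basicOpen (φ r)))
    (h : @IsLocalization.Away R _ r Γ(X, X.basicOpen (φ r)) _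
      (φ ≫ X.presheaf.map (homOfLE le_top).op).hom.toAlgebra) :
    IsOpenImmersion (hX.fromSpec ≫ toS φ) ∧
      ∀ x : Spec R, x ∈ Set.range (hX.fromSpec ≫ toS φ) ↔ x ∈ PrimeSpectrum.basicOpen r := by
  rw [toS, hX.fromSpec_toSpecΓ_assoc, ← Spec.map_comp]
  let _ : Algebra R Γ(X, X.basicOpen (φ r)) :=
    (φ ≫ X.presheaf.map (homOfLE le_top).op).hom.toAlgebra
  constructor
  · exact IsOpenImmersion.of_isLocalization (R := R) (S := Γ(X, X.basicOpen (φ r))) r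
  · intro x
    exact Set.ext_iff.mp (PrimeSpectrum.localization_away_comap_range _ r) x

lemma toS_isOpenImmersion {X : Scheme.{u}} {R : CommRingCat.{u}} (φ : R ⟶ Γ(X, ⊤))
    {ι : Type*} (r : ι → R) (hX : ∀ l, IsAffineOpen (X.basicOpen (φ (r l))))
    (hc : ⨆ l, X.basicOpen (φ (r l)) = ⊤)
    (h : ∀ l, @IsLocalization.Away R _ (r l) Γ(X, X.basicOpen (φ (r l))) _
      (φ ≫ X.presheaf.map (homOfLE le_top).op).hom.toAlgebra) :
    ∃ (_ : IsOpenImmersion (toS φ)), (toS φ).opensRange = ⨆ l, PrimeSpectrum.basicOpen (r l) := by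
  have H := fun l ↦ toS_loc φ (r l) (hX l) (h l)
  have e1 : IsOpenImmersion (toS φ) := by
    refine isOpenImmersion_of_cover (toS φ) (fun l ↦ PrimeSpectrum.basicOpen (r l)) _
      (fun l ↦ (hX l).fromSpec) ?_ ?_ fun l ↦ (H l).1
    · intro l
      rw [toS_preimage, IsAffineOpen.opensRange_fromSpec]
    · simpa only [toS_preimage] using hc
  refine ⟨e1, ?_⟩
  apply TopologicalSpace.Opens.ext
  ext x
  refine Iff.trans ?_ (TopologicalSpace.Opens.mem_iSup (x := x)).symm
  constructor
  · rintro ⟨y, rfl⟩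
    have : y ∈ ⨆ l, X.basicOpen (φ (r l)) := by rw [hc]; trivial
    obtain ⟨l, hl⟩ := TopologicalSpace.Opens.mem_iSup.mp this
    rw [← toS_preimage] at hl
    exact ⟨l, hl⟩
  · rintro ⟨l, hl⟩
    obtain ⟨y, hy⟩ := ((H l).2 x).mpr hl
    exact ⟨(hX l).fromSpec y, by rw [← hy, Scheme.Hom.comp_apply]⟩

end CDF

namespace CDF

lemma open_loc {V W : Scheme.{u}} [IsAffine V] [CompactSpace W] (i : W ⟶ V) [IsOpenImmersion i]
    (g : Γ(V, ⊤)) (hg : V.basicOpen g ≤ i.opensRange) :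
    (∀ x : Γ(W, ⊤), ∃ (n : ℕ) (a : Γ(V, ⊤)), i.appTop g ^ n * x = i.appTop a) ∧
      (∀ a : Γ(V, ⊤), i.appTop a = 0 → ∃ n : ℕ, g ^ n * a = 0) := by
  have hiso : IsIso (i.app (V.basicOpen g)) := Scheme.Hom.isIso_app i _ hg
  have hbij : Function.Bijective (i.app (V.basicOpen g)) :=
    ConcreteCategory.bijective_of_isIso _
  have hloc := (isAffineOpen_top V).isLocalization_basicOpen g
  have hle : V.basicOpen g ≤ ⊤ := le_top
  have hnat : ∀ a : Γ(V, ⊤), i.app (V.basicOpen g) (V.presheaf.map (homOfLE hle).op a) =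
      W.presheaf.map (homOfLE (show i ⁻¹ᵁ V.basicOpen g ≤ ⊤ from le_top)).op (i.appTop a) := by
    intro a
    have := i.naturality (homOfLE hle).op
    have := congrArg (fun φ ↦ φ.hom a) this
    exact this
  have hpre : i ⁻¹ᵁ V.basicOpen g = W.basicOpen (i.appTop g) := Scheme.preimage_basicOpen_top i g
  have hz : ∀ b : Γ(W, ⊤), W.presheaf.map (homOfLE (show i ⁻¹ᵁ V.basicOpen g ≤ ⊤ from le_top)).op b
      = 0 → ∃ m : ℕ, i.appTop g ^ m * b = 0 := by
    intro b hb
    refine exists_pow_mul_eq_zero_of_res_basicOpen_eq_zero_of_isCompact W (U := ⊤)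
      isCompact_univ b (i.appTop g) ?_
    have : (homOfLE (show W.basicOpen (i.appTop g) ≤ ⊤ from le_top)).op =
      (homOfLE (show i ⁻¹ᵁ V.basicOpen g ≤ ⊤ from le_top)).op ≫ (homOfLE hpre.ge).op := rfl
    change W.presheaf.map (homOfLE (show W.basicOpen (i.appTop g) ≤ ⊤ from le_top)).op b = 0
    rw [this, W.presheaf.map_comp, CommRingCat.comp_apply, hb, map_zero]
  constructor
  · intro x
    obtain ⟨y, hy⟩ := hbij.2
      (W.presheaf.map (homOfLE (show i ⁻¹ᵁ V.basicOpen g ≤ ⊤ from le_top)).op x)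
    obtain ⟨n, a, ha⟩ := IsLocalization.Away.surj g y
    replace ha : y * (V.presheaf.map (homOfLE hle).op g) ^ n =
      V.presheaf.map (homOfLE hle).op a := ha
    obtain ⟨m, hm⟩ := hz (i.appTop g ^ n * x - i.appTop a) (by
      rw [map_sub, map_mul, map_pow, ← hy, ← hnat, ← hnat, ← ha, map_mul, map_pow, mul_comm,
        sub_self])
    refine ⟨m + n, g ^ m * a, ?_⟩
    rw [map_mul, map_pow, pow_add, mul_assoc, ← sub_eq_zero, ← mul_sub, hm]
  · intro a ha
    have h0 : V.presheaf.map (homOfLE hle).op a = 0 := by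
      apply hbij.1
      rw [hnat, ha, map_zero, map_zero]
    obtain ⟨n, hn⟩ := IsLocalization.Away.exists_of_eq (S := Γ(V, V.basicOpen g)) g (a := a)
      (b := 0) (by
        rw [map_zero]
        exact h0)
    exact ⟨n, by rw [hn, mul_zero]⟩

lemma toS_preimage_iSup {X : Scheme.{u}} {R : CommRingCat.{u}} (φ : R ⟶ Γ(X, ⊤)) {ι : Type*}
    (r : ι → R) : toS φ ⁻¹ᵁ (⨆ l, PrimeSpectrum.basicOpen (r l)) = ⨆ l, X.basicOpen (φ (r l)) := by
  simp_rw [← toS_preimage]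
  exact Scheme.Hom.preimage_iSup (toS φ) (fun l ↦ PrimeSpectrum.basicOpen (r l))

lemma toS_finiteType {X : Scheme.{u}} {R : CommRingCat.{u}} (φ : R ⟶ Γ(X, ⊤))
    [LocallyOfFiniteType (toS φ)] {U : X.Opens} (hU : IsAffineOpen U) :
    (φ ≫ X.presheaf.map (homOfLE (show U ≤ ⊤ from le_top)).op).hom.FiniteType := by
  have := LocallyOfFiniteType.finiteType_appLE (toS φ) (isAffineOpen_top _) hU le_top
  have e : φ ≫ X.presheaf.map (homOfLE (show U ≤ ⊤ from le_top)).op =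
      (Scheme.ΓSpecIso R).inv ≫ (toS φ).appLE ⊤ U le_top := by
    have h2 : (toS φ).appLE ⊤ U le_top =
      (toS φ).appTop ≫ X.presheaf.map (homOfLE (show U ≤ ⊤ from le_top)).op := rfl
    rw [h2, toS_appTop]
    simp
  rw [e, CommRingCat.hom_comp]
  exact this.comp (RingHom.FiniteType.of_surjective _
    (ConcreteCategory.bijective_of_isIso (Scheme.ΓSpecIso R).inv).2)

lemma core {V W W₀ : Scheme.{u}} [IsAffine V] (i : W ⟶ V) [IsOpenImmersion i]
    [CompactSpace W] [CompactSpace W₀] [QuasiSeparatedSpace W₀] (ω : W ⟶ W₀)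
    {A₀ : CommRingCat.{u}} (α : A₀ ⟶ Γ(V, ⊤)) (β : A₀ ⟶ Γ(W₀, ⊤))
    (hαβ : α ≫ i.appTop = β ≫ ω.appTop) {ι : Type*} [Finite ι] (g : ι → Γ(V, ⊤))
    (q : ι → Γ(W₀, ⊤)) (hgq : ∀ l, ω.appTop (q l) = i.appTop (g l))
    (hg : i.opensRange = ⨆ l, V.basicOpen (g l)) (hq : ⨆ l, W₀.basicOpen (q l) = ⊤)
    (hqa : ∀ l, IsAffineOpen (W₀.basicOpen (q l))) [LocallyOfFiniteType (toS β)] :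
    ∃ (R : CommRingCat.{u}) (γ : A₀ ⟶ R) (v : R ⟶ Γ(V, ⊤)) (θ : R ⟶ Γ(W₀, ⊤)) (r : ι → R),
      γ.hom.FiniteType ∧ γ ≫ v = α ∧ γ ≫ θ = β ∧ (∀ l, v (r l) = g l) ∧ (∀ l, θ (r l) = q l) ∧
      (∀ x y, v x = v y → θ x = θ y → x = y) ∧ ∃ (_ : IsOpenImmersion (toS θ)),
      (toS θ).opensRange = ⨆ l, PrimeSpectrum.basicOpen (r l) ∧
      IsPullback ω i (toS θ) (toS v) := by
  let iA : Algebra A₀ Γ(V, ⊤) := α.hom.toAlgebra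
  let iQ : Algebra A₀ Γ(W₀, ⊤) := β.hom.toAlgebra
  let iG : Algebra A₀ Γ(W, ⊤) := (α ≫ i.appTop).hom.toAlgebra
  let iL (l) : Algebra A₀ Γ(W₀, W₀.basicOpen (q l)) :=
    (β ≫ W₀.presheaf.map (homOfLE (show W₀.basicOpen (q l) ≤ ⊤ from le_top)).op).hom.toAlgebra
  let ρ : Γ(V, ⊤) →ₐ[A₀] Γ(W, ⊤) := ⟨i.appTop.hom, fun _ ↦ rfl⟩
  let σ : Γ(W₀, ⊤) →ₐ[A₀] Γ(W, ⊤) := ⟨ω.appTop.hom, fun a ↦ congrArg (fun φ ↦ φ.hom a) hαβ.symm⟩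
  let τ (l) : Γ(W₀, ⊤) →ₐ[A₀] Γ(W₀, W₀.basicOpen (q l)) :=
    ⟨(W₀.presheaf.map (homOfLE (show W₀.basicOpen (q l) ≤ ⊤ from le_top)).op).hom, fun _ ↦ rfl⟩
  let P := AlgHom.equalizer (σ.comp (AlgHom.fst A₀ Γ(W₀, ⊤) Γ(V, ⊤)))
    (ρ.comp (AlgHom.snd A₀ Γ(W₀, ⊤) Γ(V, ⊤)))
  have hloc := fun l ↦ fiberProd_loc ρ σ (τ l) (q l) (g l) (hgq l)
    (isLocalization_basicOpen_of_qcqs isCompact_univ isQuasiSeparated_univ (q l))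
    (open_loc i (g l) (hg ▸ le_iSup (fun l ↦ V.basicOpen (g l)) l)).1
    (open_loc i (g l) (hg ▸ le_iSup (fun l ↦ V.basicOpen (g l)) l)).2
  have hft : ∀ l, Algebra.FiniteType A₀ Γ(W₀, W₀.basicOpen (q l)) := by
    intro l
    exact RingHom.finiteType_algebraMap.mp (toS_finiteType β (hqa l))
  obtain ⟨R, hRfg, -, hr, hR⟩ := exists_subalgebra (A₀ := A₀) (P := P)
    (fun l ↦ ⟨(q l, g l), hgq l⟩) (fun l ↦ Γ(W₀, W₀.basicOpen (q l)))
    (fun l ↦ ((τ l).comp (AlgHom.fst A₀ Γ(W₀, ⊤) Γ(V, ⊤))).comp P.val) hloc ∅ Set.finite_empty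
  let v : CommRingCat.of R ⟶ Γ(V, ⊤) :=
    CommRingCat.ofHom (((AlgHom.snd A₀ Γ(W₀, ⊤) Γ(V, ⊤)).comp P.val).comp R.val).toRingHom
  let θ : CommRingCat.of R ⟶ Γ(W₀, ⊤) :=
    CommRingCat.ofHom (((AlgHom.fst A₀ Γ(W₀, ⊤) Γ(V, ⊤)).comp P.val).comp R.val).toRingHom
  let r : ι → CommRingCat.of R := fun l ↦ ⟨⟨(q l, g l), hgq l⟩, hr l⟩
  obtain ⟨e1, e2⟩ := toS_isOpenImmersion θ r hqa hq hR
  refine ⟨CommRingCat.of R, CommRingCat.ofHom (algebraMap A₀ R), v, θ, r, ?_, rfl, rfl,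
    fun _ ↦ rfl, fun _ ↦ rfl, ?_, e1, e2, ?_⟩
  · exact RingHom.finiteType_algebraMap.mpr (R.fg_iff_finiteType.mp hRfg)
  · intro x y h1 h2
    exact Subtype.ext (Subtype.ext (Prod.ext h2 h1))
  · refine IsOpenImmersion.isPullback _ _ _ _ ?_ ?_
    · rw [comp_toS, comp_toS]
      congr 1
      ext x
      exact x.1.2.symm
    · rw [e2, hg]
      exact toS_preimage_iSup v r

end CDF

namespace CDF

lemma zlAff : IsZariskiLocalAtTarget @IsAffineHom.{u} :=
  @HasAffineProperty.instIsZariskiLocalAtTarget _ _ instHasAffinePropertyIsAffineHomIsAffine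

lemma zlFT : IsZariskiLocalAtTarget @LocallyOfFiniteType.{u} :=
  @HasRingHomProperty.instIsZariskiLocalAtTarget _ _ inferInstance

lemma exists_basicOpens {A : CommRingCat.{u}} (U : (Spec A).Opens) (hU : IsCompact (U : Set (Spec A))) :
    ∃ (s : Set A) (_ : Finite s), U = ⨆ l : s, PrimeSpectrum.basicOpen (l : A) := by
  obtain ⟨t, ht⟩ := PrimeSpectrum.isCompact_isOpen_iff.mp ⟨hU, U.2⟩
  refine ⟨t, inferInstance, ?_⟩
  apply TopologicalSpace.Opens.ext
  ext x
  rw [← ht]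
  refine Iff.trans ?_ (TopologicalSpace.Opens.mem_iSup (x := x)).symm
  refine Iff.trans (Set.not_subset (s := (t : Set A))) ?_
  constructor
  · rintro ⟨a, ha, hx⟩
    exact ⟨⟨a, ha⟩, hx⟩
  · rintro ⟨⟨a, ha⟩, hx⟩
    exact ⟨a, ha, hx⟩

lemma opensRange_of_isPullback {P X Y Z : Scheme.{u}} {a : P ⟶ X} {b : P ⟶ Y} {f : X ⟶ Z}
    {g : Y ⟶ Z} (h : IsPullback a b f g) [IsOpenImmersion f] [IsOpenImmersion b] :
    b.opensRange = g ⁻¹ᵁ f.opensRange := by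
  ext y
  constructor
  · rintro ⟨p, rfl⟩
    exact ⟨a p, by rw [← Scheme.Hom.comp_apply, h.w, Scheme.Hom.comp_apply]⟩
  · rintro ⟨x, hx⟩
    obtain ⟨p, -, hp⟩ := exists_pt h x y hx
    exact ⟨p, hp⟩

lemma ext_step {O C B BO N : Scheme.{u}} [IsNoetherian C] {A₀ : CommRingCat.{u}} (o : O ⟶ C)
    (j : Spec A₀ ⟶ C) [IsOpenImmersion o] [IsOpenImmersion j]
    (hc : o.opensRange ⊔ j.opensRange = ⊤) (π : B ⟶ C) [IsAffineHom π]
    (iO : BO ⟶ B) (πO : BO ⟶ O) (hBO : IsPullback iO πO π o)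
    (a : N ⟶ O) [IsAffineHom a] [LocallyOfFiniteType a] (n : BO ⟶ N) (hn : n ≫ a = πO) :
    ∃ (T : Scheme.{u}) (p : T ⟶ C) (b : B ⟶ T) (k : N ⟶ T), IsAffineHom p ∧
      LocallyOfFiniteType p ∧ b ≫ p = π ∧ IsPullback k a p o ∧ n ≫ k = iO ≫ b := by
  have : IsOpenImmersion iO := MorphismProperty.of_isPullback hBO.flip inferInstance
  have : IsAffineHom πO := MorphismProperty.of_isPullback hBO inferInstance
  have : IsLocallyNoetherian O := LocallyOfFiniteType.isLocallyNoetherian o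
  have : IsNoetherian O := { isCompact_univ := (QuasiCompact.compactSpace_of_compactSpace o).isCompact_univ }
  have : IsAffineHom n := by
    have : IsAffineHom (n ≫ a) := hn ▸ inferInstance
    exact .of_comp n a
  -- intersections
  let W' := pullback o j
  let o' : W' ⟶ O := pullback.fst o j
  let j' : W' ⟶ Spec A₀ := pullback.snd o j
  have hW' : IsPullback o' j' o j := IsPullback.of_hasPullback o j
  have : IsOpenImmersion o' := inferInstanceAs (IsOpenImmersion (pullback.fst o j))
  have : IsOpenImmersion j' := inferInstanceAs (IsOpenImmersion (pullback.snd o j))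
  have : CompactSpace W' := QuasiCompact.compactSpace_of_compactSpace o'
  let W₀ := pullback a o'
  let a0 : W₀ ⟶ N := pullback.fst a o'
  let w0 : W₀ ⟶ W' := pullback.snd a o'
  have hW₀ : IsPullback a0 w0 a o' := IsPullback.of_hasPullback a o'
  have : IsOpenImmersion a0 := inferInstanceAs (IsOpenImmersion (pullback.fst a o'))
  have : IsAffineHom w0 := MorphismProperty.of_isPullback hW₀ inferInstance
  have : LocallyOfFiniteType w0 := inferInstanceAs (LocallyOfFiniteType (pullback.snd a o'))
  have : CompactSpace W₀ := QuasiCompact.compactSpace_of_compactSpace w0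
  have : IsLocallyNoetherian W₀ := LocallyOfFiniteType.isLocallyNoetherian (w0 ≫ o')
  let W := pullback a0 n
  let ω : W ⟶ W₀ := pullback.fst a0 n
  let wO : W ⟶ BO := pullback.snd a0 n
  have hW : IsPullback ω wO a0 n := IsPullback.of_hasPullback a0 n
  have : IsAffineHom ω := MorphismProperty.of_isPullback hW.flip inferInstance
  have : CompactSpace W := QuasiCompact.compactSpace_of_compactSpace ω
  let V := pullback j π
  let pV : V ⟶ Spec A₀ := pullback.fst j π
  let iV : V ⟶ B := pullback.snd j π
  have hV : IsPullback pV iV j π := IsPullback.of_hasPullback j π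
  have : IsOpenImmersion iV := inferInstanceAs (IsOpenImmersion (pullback.snd j π))
  have : IsAffineHom pV := inferInstanceAs (IsAffineHom (pullback.fst j π))
  have : IsAffine V := isAffine_of_isAffineHom pV
  -- the map `W ⟶ V`
  have hW1 : IsPullback (ω ≫ w0) wO o' πO := by
    rw [← hn]
    exact IsPullback.paste_horiz hW hW₀.flip
  have hW2 : IsPullback (ω ≫ w0 ≫ j') wO j (iO ≫ π) := by
    rw [hBO.w, ← Category.assoc]
    exact IsPullback.paste_horiz hW1 hW'.flip
  obtain ⟨i, hi1, hi2⟩ : ∃ i : W ⟶ V, i ≫ pV = ω ≫ w0 ≫ j' ∧ i ≫ iV = wO ≫ iO :=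
    ⟨hV.lift (ω ≫ w0 ≫ j') (wO ≫ iO) (by rw [hW2.w, Category.assoc]), hV.lift_fst _ _ _,
      hV.lift_snd _ _ _⟩
  have hi : IsPullback i wO iV iO := by
    refine IsPullback.of_right (h₁₂ := pV) (h₂₂ := π) (v₁₃ := j) ?_ hi2 hV
    rw [hi1]
    exact hW2
  have hio : IsOpenImmersion i := MorphismProperty.of_isPullback hi.flip inferInstance
  have hir : i.opensRange = pV ⁻¹ᵁ j'.opensRange := by
    have h1 : j'.opensRange = j ⁻¹ᵁ o.opensRange := opensRange_of_isPullback hW'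
    have h2 : iO.opensRange = π ⁻¹ᵁ o.opensRange := opensRange_of_isPullback hBO.flip
    have h3 : i.opensRange = iV ⁻¹ᵁ iO.opensRange := opensRange_of_isPullback hi.flip
    rw [h1, h3, h2, ← Scheme.Hom.comp_preimage, ← Scheme.Hom.comp_preimage, hV.w]
  -- ring data
  obtain ⟨α, hα⟩ := exists_toS pV
  obtain ⟨β, hβ⟩ := exists_toS (w0 ≫ j')
  have hLOFT : LocallyOfFiniteType (toS β) := hβ ▸ inferInstance
  obtain ⟨s, hs, hsU⟩ := exists_basicOpens j'.opensRange (isCompact_range j'.continuous)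
  have hαβ : α ≫ i.appTop = β ≫ ω.appTop := by
    apply toS_inj
    rw [← comp_toS, ← comp_toS, ← hα, ← hβ, hi1]
  have hqo : ∀ l : s, W₀.basicOpen (β (l : A₀)) = w0 ⁻¹ᵁ (j' ⁻¹ᵁ PrimeSpectrum.basicOpen (l : A₀)) := by
    intro l
    exact (toS_preimage β (l : A₀)).symm.trans (by rw [← hβ]; rfl)
  obtain ⟨R, γ, v, θ, r, h1, h2, h3, h4, h5, h6, h7, h8, h9⟩ := core i ω α β hαβ
    (fun l : s ↦ α (l : A₀)) (fun l : s ↦ β (l : A₀))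
    (fun l ↦ (congrArg (fun φ ↦ φ.hom (l : A₀)) hαβ).symm)
    (by rw [hir, hsU, hα]; exact toS_preimage_iSup α (fun l : s ↦ (l : A₀)))
    (by
      refine (toS_preimage_iSup β (fun l : s ↦ (l : A₀))).symm.trans ?_
      refine (congrArg (fun U ↦ toS β ⁻¹ᵁ U) hsU.symm).trans ?_
      rw [← hβ, Scheme.Hom.comp_preimage, j'.preimage_opensRange]
      rfl)
    (by
      intro l
      rw [hqo]
      refine IsAffineOpen.preimage ?_ w0
      refine IsAffineOpen.preimage_of_isOpenImmersion ?_ j' ?_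
      · rw [← basicOpen_eq_of_affine]
        exact (isAffineOpen_top _).basicOpen _
      · rw [hsU]
        exact le_iSup (fun l : s ↦ (PrimeSpectrum.basicOpen (l : A₀))) l)
  have hr : ∀ l, r l = γ (l : A₀) := by
    intro l
    apply h6
    · rw [h4, ← h2]; rfl
    · rw [h5, ← h3]; rfl
  have hLR : LocallyOfFiniteType (Spec.map γ) := by
    rw [HasRingHomProperty.Spec_iff (P := @LocallyOfFiniteType)]
    exact h1
  have hθγ : toS θ ≫ Spec.map γ = w0 ≫ j' := by rw [toS_comp, h3, hβ]
  have hvγ : toS v ≫ Spec.map γ = pV := by rw [toS_comp, h2, hα]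
  have hT0 : IsPullback w0 (toS θ) j' (Spec.map γ) := by
    refine IsOpenImmersion.isPullback _ _ _ _ hθγ ?_
    rw [h8, hsU]
    ext x
    refine (TopologicalSpace.Opens.mem_iSup (x := Spec.map γ x)).trans
      (Iff.trans ?_ (TopologicalSpace.Opens.mem_iSup (x := x)).symm)
    refine exists_congr fun l ↦ ?_
    rw [hr l]
    rfl
  obtain ⟨T, k, e, ok, oe, hT, hk⟩ := exists_glue a0 (toS θ)
  obtain ⟨p, hp1, hp2⟩ := glue_map k e hT hk o j hW' a (Spec.map γ) w0 hW₀.flip hT0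
  have hB : iO.opensRange ⊔ iV.opensRange = ⊤ := by
    rw [opensRange_of_isPullback hBO.flip, opensRange_of_isPullback hV, ← Scheme.Hom.preimage_sup,
      hc]
    rfl
  obtain ⟨b, hb1, hb2⟩ := glue_map iO iV hB hi.flip k e hk n (toS v) ω hW h9
  refine ⟨T, p, b, k, ?_, ?_, ?_, hp1.flip, hb1.w⟩
  · have := zlAff.{u}
    exact local2 @IsAffineHom.{u} o j hc p hp1 hp2 inferInstance inferInstance
  · have := zlFT.{u}
    exact local2 @LocallyOfFiniteType.{u} o j hc p hp1 hp2 inferInstance inferInstance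
  · apply hom_ext2 iO iV hB
    · rw [← reassoc_of% hb1.w, ← hp1.w, reassoc_of% hn, hBO.w]
    · rw [← reassoc_of% hb2.w, ← hp2.w, reassoc_of% hvγ, hV.w]

end CDF

namespace CDF

lemma isPullback_homOfLE {B C : Scheme.{u}} (π : B ⟶ C) {U U' : C.Opens} (h : U ≤ U') :
    IsPullback (B.homOfLE (π.preimage_mono h)) (π ∣_ U) (π ∣_ U') (C.homOfLE h) := by
  refine IsPullback.of_right (h₁₂ := (π ⁻¹ᵁ U').ι) (h₂₂ := U'.ι) (v₁₃ := π) ?_ ?_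
    (isPullback_morphismRestrict π U').flip
  · simpa using (isPullback_morphismRestrict π U).flip
  · rw [← cancel_mono U'.ι]
    simp

lemma exists_cover_sup {C : Scheme.{u}} (U : C.Opens) (V : C.affineOpens) :
    ∃ (A₀ : CommRingCat.{u}) (j : Spec A₀ ⟶ (U ⊔ V.1 : C.Opens)) (_ : IsOpenImmersion j),
      (C.homOfLE (le_sup_left : U ≤ U ⊔ V.1)).opensRange ⊔ j.opensRange = ⊤ ∧
      (j ≫ (U ⊔ V.1).ι).opensRange = V.1 := by
  have hf : IsOpenImmersion V.2.fromSpec := V.2.isOpenImmersion_fromSpec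
  have hr : V.2.fromSpec.opensRange ≤ (U ⊔ V.1 : C.Opens).ι.opensRange := by
    rw [V.2.opensRange_fromSpec, Scheme.Opens.opensRange_ι]
    exact le_sup_right
  let j := IsOpenImmersion.lift (U ⊔ V.1).ι V.2.fromSpec hr
  have hj : j ≫ (U ⊔ V.1).ι = V.2.fromSpec := IsOpenImmersion.lift_fac _ _ _
  have hjo : IsOpenImmersion j := by
    have : IsOpenImmersion (j ≫ (U ⊔ V.1).ι) := by
      rw [hj]; infer_instance
    exact .of_comp _ (U ⊔ V.1).ι
  have hj2 : (j ≫ (U ⊔ V.1).ι).opensRange = V.1 := by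
    simp only [hj, V.2.opensRange_fromSpec]
  refine ⟨Γ(C, V), j, hjo, ?_, hj2⟩
  rw [eq_top_iff]
  rintro ⟨x, hx⟩ -
  rcases hx with hx | hx
  · exact Or.inl ⟨⟨x, hx⟩, by apply Subtype.ext; simp⟩
  · right
    have hx' : x ∈ (j ≫ (U ⊔ V.1).ι).opensRange := by rw [hj2]; exact hx
    obtain ⟨y, hy⟩ := hx'
    refine ⟨y, Subtype.ext ?_⟩
    exact hy

lemma ext_all {B C : Scheme.{u}} [IsNoetherian C] (π : B ⟶ C) [IsAffineHom π] (O : C.Opens)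
    {N : Scheme.{u}} (a : N ⟶ O) [IsAffineHom a] [LocallyOfFiniteType a]
    (n : (π ⁻¹ᵁ O).toScheme ⟶ N) (hn : n ≫ a = π ∣_ O) :
    ∃ (T : Scheme.{u}) (p : T ⟶ C) (b : B ⟶ T) (k : N ⟶ T), IsAffineHom p ∧
      LocallyOfFiniteType p ∧ b ≫ p = π ∧ IsPullback k a p O.ι ∧ n ≫ k = (π ⁻¹ᵁ O).ι ≫ b := by
  have key : ∀ S : C.Opens, ∃ (U : C.Opens) (hS : S ≤ U) (hU : O ≤ U)
      (T : Scheme.{u}) (p : T ⟶ U) (b : (π ⁻¹ᵁ U).toScheme ⟶ T) (k : N ⟶ T), IsAffineHom p ∧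
      LocallyOfFiniteType p ∧ b ≫ p = π ∣_ U ∧ IsPullback k a p (C.homOfLE hU) ∧
      n ≫ k = B.homOfLE (π.preimage_mono hU) ≫ b := by
    intro S
    refine compact_open_induction_on S (TopologicalSpace.NoetherianSpace.isCompact _) ?_ ?_
    · refine ⟨O, bot_le, le_rfl, N, a, n, 𝟙 N, inferInstance, inferInstance, hn, ?_, ?_⟩
      · simpa using IsPullback.of_horiz_isIso (fst := 𝟙 N) (snd := a) (f := a) (g := 𝟙 _) ⟨by simp⟩
      · simp
    · rintro S - V ⟨U, hS, hU, T, p, b, k, h1, h2, h3, h4, h5⟩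
      obtain ⟨A₀, j, hj, hc, -⟩ := exists_cover_sup U V
      have : IsLocallyNoetherian (U ⊔ V.1 : C.Opens) :=
        LocallyOfFiniteType.isLocallyNoetherian (U ⊔ V.1 : C.Opens).ι
      have : IsNoetherian (U ⊔ V.1 : C.Opens) :=
        { isCompact_univ := (QuasiCompact.compactSpace_of_compactSpace (U ⊔ V.1).ι).isCompact_univ }
      have : IsAffineHom (π ∣_ (U ⊔ V.1)) :=
        MorphismProperty.of_isPullback (isPullback_morphismRestrict π _).flip inferInstance
      obtain ⟨T', p', b', k', e1, e2, e3, e4, e5⟩ := ext_step (C.homOfLE (le_sup_left : U ≤ U ⊔ V.1)) j hc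
        (π ∣_ (U ⊔ V.1)) _ _ (isPullback_homOfLE π le_sup_left) p b h3
      refine ⟨U ⊔ V.1, sup_le_sup hS le_rfl, hU.trans le_sup_left, T', p', b', k ≫ k', e1, e2, e3, ?_, ?_⟩
      · simpa using h4.paste_horiz e4
      · rw [reassoc_of% h5, e5]; simp
  obtain ⟨U, hS, hU, T, p, b, k, h1, h2, h3, h4, h5⟩ := key ⊤
  obtain rfl : U = ⊤ := top_le_iff.mp hS
  have t1 : IsIso (⊤ : C.Opens).ι := inferInstanceAs (IsIso C.topIso.hom)
  have t2 : IsIso (π ⁻¹ᵁ (⊤ : C.Opens)).ι := inferInstanceAs (IsIso B.topIso.hom)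
  refine ⟨T, p ≫ (⊤ : C.Opens).ι, inv (π ⁻¹ᵁ (⊤ : C.Opens)).ι ≫ b, k, inferInstance,
    inferInstance, ?_, ?_, ?_⟩
  · rw [Category.assoc, reassoc_of% h3, morphismRestrict_ι, IsIso.inv_hom_id_assoc]
  · have h6 : IsPullback (𝟙 T) p (p ≫ (⊤ : C.Opens).ι) (⊤ : C.Opens).ι :=
      IsPullback.of_horiz_isIso ⟨by simp⟩
    simpa using h4.paste_horiz h6
  · rw [h5, ← Category.assoc]
    congr 1
    rw [IsIso.eq_comp_inv]
    exact B.homOfLE_ι (π.preimage_mono hU)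

end CDF

namespace CDF

/-! ### Maps into affine opens -/

lemma toA_appLE {W X : Scheme.{u}} {A : X.Opens} (hA : IsAffineOpen A) (φ : Γ(X, A) ⟶ Γ(W, ⊤)) :
    ∃ h : ⊤ ≤ (toS φ ≫ hA.fromSpec) ⁻¹ᵁ A, (toS φ ≫ hA.fromSpec).appLE A ⊤ h = φ := by
  have h0 : ⊤ ≤ hA.fromSpec ⁻¹ᵁ A := by rw [hA.fromSpec_preimage_self]
  refine ⟨?_, ?_⟩
  · rw [Scheme.Hom.comp_preimage, hA.fromSpec_preimage_self]; rfl
  · rw [← Scheme.Hom.appLE_comp_appLE (toS φ) hA.fromSpec A ⊤ ⊤ h0 le_rfl]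
    have e1 : (toS φ).appLE ⊤ ⊤ le_rfl = (toS φ).appTop := Scheme.Hom.appLE_eq_app _
    rw [e1, toS_appTop]
    have e2 : hA.fromSpec.appLE A ⊤ h0 = (Scheme.ΓSpecIso _).inv := by
      rw [Scheme.Hom.appLE, hA.fromSpec_app_self, Category.assoc, ← Functor.map_comp]
      refine (congrArg (fun f ↦ (Scheme.ΓSpecIso _).inv ≫ (Spec _).presheaf.map f)
        (Subsingleton.elim _ (𝟙 _))).trans ?_
      simp
    rw [e2]
    simp

lemma exists_toA {W X : Scheme.{u}} {A : X.Opens} (hA : IsAffineOpen A) (m : W ⟶ X)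
    (h : ⊤ ≤ m ⁻¹ᵁ A) : m = toS (m.appLE A ⊤ h) ≫ hA.fromSpec := by
  have hf := hA.isOpenImmersion_fromSpec
  have hr : Set.range m ⊆ Set.range hA.fromSpec := by
    rw [hA.range_fromSpec]
    rintro _ ⟨x, rfl⟩
    exact h (show x ∈ ⊤ from trivial)
  obtain ⟨φ, hφ⟩ := exists_toS (IsOpenImmersion.lift hA.fromSpec m hr)
  have e : m = toS φ ≫ hA.fromSpec := by
    rw [← hφ, IsOpenImmersion.lift_fac]
  obtain ⟨h', e'⟩ := toA_appLE hA φ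
  subst e
  rw [e']

lemma hom_ext_affine {W X : Scheme.{u}} {A : X.Opens} (hA : IsAffineOpen A) (m m' : W ⟶ X)
    (h : ⊤ ≤ m ⁻¹ᵁ A) (h' : ⊤ ≤ m' ⁻¹ᵁ A) (e : m.appLE A ⊤ h = m'.appLE A ⊤ h') : m = m' := by
  rw [exists_toA hA m h, exists_toA hA m' h', e]

/-- A ring-theoretic gluing lemma. -/
lemma ring_desc {ι : Type*} {R : ι → Type*} [∀ i, CommRing (R i)] {P Q : Type*} [CommRing P]
    [CommRing Q] (φ : ∀ i, R i →+* P) (ψ : ∀ i, R i →+* Q)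
    (h1 : ∀ x y, ∃ i a b, φ i a = x ∧ φ i b = y)
    (h2 : ∀ i j a b, φ i a = φ j b → ψ i a = ψ j b) : ∃ χ : P →+* Q, ∀ i a, χ (φ i a) = ψ i a := by
  have h3 : ∀ x, ∃ i a, φ i a = x := fun x ↦ by
    obtain ⟨i, a, -, h, -⟩ := h1 x x
    exact ⟨i, a, h⟩
  choose i a ha using h3
  have key : ∀ j b, ψ (i (φ j b)) (a (φ j b)) = ψ j b := fun j b ↦ h2 _ _ _ _ (ha _)
  refine ⟨{ toFun := fun x ↦ ψ (i x) (a x), map_one' := ?_, map_zero' := ?_, map_mul' := ?_,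
            map_add' := ?_ }, key⟩
  · rw [← map_one (ψ (i 1))]
    exact h2 _ _ _ _ (by rw [ha, map_one])
  · intro x y
    obtain ⟨j, b, c, rfl, rfl⟩ := h1 x y
    rw [key, key, ← map_mul (φ j), key, map_mul]
  · rw [← map_zero (ψ (i 0))]
    exact h2 _ _ _ _ (by rw [ha, map_zero])
  · intro x y
    obtain ⟨j, b, c, rfl, rfl⟩ := h1 x y
    rw [key, key, ← map_add (φ j), key, map_add]

lemma le_pre {B T B₀ : Scheme.{u}} {b : B ⟶ T} {p : T ⟶ B₀} {π : B ⟶ B₀} (h : b ≫ p = π)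
    (V : B₀.Opens) : π ⁻¹ᵁ V ≤ b ⁻¹ᵁ (p ⁻¹ᵁ V) := by
  rw [← Scheme.Hom.comp_preimage, h]

lemma isOpenCover_pre {W B₀ : Scheme.{u}} (w : W ⟶ B₀) :
    TopologicalSpace.IsOpenCover (fun V : B₀.affineOpens ↦ w ⁻¹ᵁ V.1) := by
  have := congrArg (fun U ↦ w ⁻¹ᵁ U) (iSup_affineOpens_eq_top B₀)
  rw [Scheme.Hom.preimage_iSup] at this
  exact this

lemma hom_ext_cover {W B₀ X : Scheme.{u}} (w : W ⟶ B₀) (m m' : W ⟶ X)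
    (h : ∀ V : B₀.Opens, IsAffineOpen V → (w ⁻¹ᵁ V).ι ≫ m = (w ⁻¹ᵁ V).ι ≫ m') : m = m' :=
  (W.openCoverOfIsOpenCover (fun V : B₀.affineOpens ↦ w ⁻¹ᵁ V.1) (isOpenCover_pre w)).hom_ext _ _
    (fun V ↦ h V.1 V.2)

lemma top_le_pre {W X B₀ : Scheme.{u}} (w : W ⟶ B₀) (V : B₀.Opens) {m : W ⟶ X} {π : X ⟶ B₀}
    (h : m ≫ π = w) : ⊤ ≤ ((w ⁻¹ᵁ V).ι ≫ m) ⁻¹ᵁ (π ⁻¹ᵁ V) := by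
  rw [← Scheme.Hom.comp_preimage, Category.assoc, h, Scheme.Hom.comp_preimage,
    Scheme.Opens.ι_preimage_self]

lemma limit_uniq {B B₀ : Scheme.{u}} (π : B ⟶ B₀) [IsAffineHom π] {ι : Type*}
    (T : ι → Scheme.{u}) (b : ∀ i, B ⟶ T i) (p : ∀ i, T i ⟶ B₀) (h : ∀ i, b i ≫ p i = π)
    [Nonempty ι] (surj : ∀ V : B₀.Opens, IsAffineOpen V → ∀ f : Γ(B, π ⁻¹ᵁ V), ∃ i a,
      (b i).appLE (p i ⁻¹ᵁ V) (π ⁻¹ᵁ V) (le_pre (h i) V) a = f) {W : Scheme.{u}} (m m' : W ⟶ B)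
    (e : ∀ i, m ≫ b i = m' ≫ b i) : m = m' := by
  obtain ⟨i0⟩ := ‹Nonempty ι›
  have hπ : m' ≫ π = m ≫ π := by
    rw [← h i0, reassoc_of% (e i0)]
  refine hom_ext_cover (m ≫ π) _ _ fun V hV ↦ ?_
  refine hom_ext_affine (hV.preimage π) _ _ (top_le_pre _ V rfl) (top_le_pre _ V hπ) ?_
  ext f
  obtain ⟨i, a, rfl⟩ := surj V hV f
  rw [← CommRingCat.comp_apply, ← CommRingCat.comp_apply, Scheme.Hom.appLE_comp_appLE,
    Scheme.Hom.appLE_comp_appLE]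
  simp only [Category.assoc, e i]

lemma limit_exists {B B₀ : Scheme.{u}} (π : B ⟶ B₀) [IsAffineHom π] {I : Type*}
    [Category I] [IsCofiltered I] (D : I ⥤ Scheme.{u}) (b : ∀ i, B ⟶ D.obj i)
    (hb : ∀ {i j} (f : i ⟶ j), b i ≫ D.map f = b j)
    (p : ∀ i, D.obj i ⟶ B₀) (hp : ∀ {i j} (f : i ⟶ j), D.map f ≫ p j = p i)
    [∀ i, IsAffineHom (p i)] (h : ∀ i, b i ≫ p i = π)
    (surj : ∀ V : B₀.Opens, IsAffineOpen V → ∀ f : Γ(B, π ⁻¹ᵁ V), ∃ i a,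
      (b i).appLE (p i ⁻¹ᵁ V) (π ⁻¹ᵁ V) (le_pre (h i) V) a = f)
    (inj : ∀ V : B₀.Opens, IsAffineOpen V → ∀ i,
      Function.Injective ((b i).appLE (p i ⁻¹ᵁ V) (π ⁻¹ᵁ V) (le_pre (h i) V)))
    {W : Scheme.{u}} (s : ∀ i, W ⟶ D.obj i) (hs : ∀ {i j} (f : i ⟶ j), s i ≫ D.map f = s j) :
    ∃ m : W ⟶ B, ∀ i, m ≫ b i = s i := by
  obtain ⟨i0⟩ := IsCofiltered.nonempty (C := I)
  obtain ⟨w, hw⟩ : ∃ w : W ⟶ B₀, ∀ i, s i ≫ p i = w := by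
    refine ⟨s i0 ≫ p i0, fun i ↦ ?_⟩
    rw [← hs (IsCofiltered.minToLeft i i0), ← hs (IsCofiltered.minToRight i i0), Category.assoc,
      Category.assoc, hp, hp]
  have loc : ∀ V : B₀.affineOpens, ∃ m : (w ⁻¹ᵁ V.1).toScheme ⟶ B,
      ∀ i, m ≫ b i = (w ⁻¹ᵁ V.1).ι ≫ s i := by
    intro V
    let φ : ∀ i, Γ(D.obj i, p i ⁻¹ᵁ V.1) ⟶ Γ(B, π ⁻¹ᵁ V.1) := fun i ↦
      (b i).appLE (p i ⁻¹ᵁ V) (π ⁻¹ᵁ V) (le_pre (h i) V)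
    let ψ : ∀ i, Γ(D.obj i, p i ⁻¹ᵁ V.1) ⟶ Γ((w ⁻¹ᵁ V.1).toScheme, ⊤) := fun i ↦
      ((w ⁻¹ᵁ V.1).ι ≫ s i).appLE (p i ⁻¹ᵁ V) ⊤ (top_le_pre w V (hw i))
    let τ : ∀ {i j} (f : i ⟶ j), Γ(D.obj j, p j ⁻¹ᵁ V.1) ⟶ Γ(D.obj i, p i ⁻¹ᵁ V.1) := fun f ↦
      (D.map f).appLE _ _ (le_pre (hp f) V.1)
    have hτφ : ∀ {i j} (f : i ⟶ j), τ f ≫ φ i = φ j := by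
      intro i j f
      simp only [τ, φ, Scheme.Hom.appLE_comp_appLE, hb]
    have hτψ : ∀ {i j} (f : i ⟶ j), τ f ≫ ψ i = ψ j := by
      intro i j f
      simp only [τ, ψ, Scheme.Hom.appLE_comp_appLE, hs, Category.assoc]
    have hτφ' : ∀ {i j} (f : i ⟶ j) x, φ i (τ f x) = φ j x := by
      intro i j f x
      rw [← hτφ f]; rfl
    have hτψ' : ∀ {i j} (f : i ⟶ j) x, ψ i (τ f x) = ψ j x := by
      intro i j f x
      rw [← hτψ f]; rfl
    obtain ⟨χ, hχ⟩ := ring_desc (fun i ↦ (φ i).hom) (fun i ↦ (ψ i).hom) (by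
        intro x y
        obtain ⟨i, a, rfl⟩ := surj V V.2 x
        obtain ⟨j, a', rfl⟩ := surj V V.2 y
        exact ⟨IsCofiltered.min i j, τ (IsCofiltered.minToLeft i j) a,
          τ (IsCofiltered.minToRight i j) a', hτφ' _ _, hτφ' _ _⟩) (by
        intro i j a a' e
        replace e : φ i a = φ j a' := e
        change ψ i a = ψ j a'
        rw [← hτφ' (IsCofiltered.minToLeft i j), ← hτφ' (IsCofiltered.minToRight i j)] at e
        rw [← hτψ' (IsCofiltered.minToLeft i j), ← hτψ' (IsCofiltered.minToRight i j),
          inj V V.2 _ e])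
    let χ' : Γ(B, π ⁻¹ᵁ V.1) ⟶ Γ((w ⁻¹ᵁ V.1).toScheme, ⊤) := CommRingCat.ofHom χ
    obtain ⟨hm, em⟩ := toA_appLE (V.2.preimage π) χ'
    refine ⟨toS χ' ≫ (V.2.preimage π).fromSpec, fun i ↦ ?_⟩
    refine hom_ext_affine (V.2.preimage (p i)) _ _ ?_ (top_le_pre w V (hw i)) ?_
    · rw [Scheme.Hom.comp_preimage]
      exact hm.trans (Scheme.Hom.preimage_mono _ (le_pre (h i) V.1))
    · rw [← Scheme.Hom.appLE_comp_appLE _ (b i) _ _ _ (le_pre (h i) V.1) hm, em]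
      ext a
      exact hχ i a
  choose m hm using loc
  let 𝒰 := W.openCoverOfIsOpenCover (fun V : B₀.affineOpens ↦ w ⁻¹ᵁ V.1) (isOpenCover_pre w)
  have : Nonempty I := ⟨i0⟩
  obtain ⟨m', hm'⟩ : ∃ m' : ∀ V : 𝒰.I₀, 𝒰.X V ⟶ B, ∀ V i, m' V ≫ b i = 𝒰.f V ≫ s i := ⟨m, hm⟩
  refine ⟨𝒰.glueMorphisms m' ?_, fun i ↦ ?_⟩
  · intro V V'
    refine limit_uniq π _ b p h surj _ _ fun i ↦ ?_
    rw [Category.assoc, Category.assoc, hm', hm', pullback.condition_assoc]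
  · refine 𝒰.hom_ext _ _ fun V ↦ ?_
    rw [Scheme.Cover.ι_glueMorphisms_assoc, hm']

end CDF

namespace CDF

/-! ### Countability -/

lemma countable_ideal (R : Type*) [CommRing R] [Countable R] [IsNoetherianRing R] :
    Countable (Ideal R) := by
  have h : ∀ I : Ideal R, ∃ s : Finset R, Ideal.span (s : Set R) = I :=
    fun I ↦ IsNoetherian.noetherian I
  choose s hs using h
  exact Function.Injective.countable (f := s) fun I J e ↦ by rw [← hs I, ← hs J, e]

lemma countable_mvPoly (n : ℕ) : Countable (MvPolynomial (Fin n) ℤ) := by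
  have := MvPolynomial.cardinalMk_le_max (σ := Fin n) (R := ℤ)
  rw [← Cardinal.mk_le_aleph0_iff]
  refine this.trans ?_
  simp

lemma countable_ringHom (R S : Type*) [CommRing R] [CommRing S] [Algebra.FiniteType ℤ R]
    [Countable S] : Countable (R →+* S) := by
  obtain ⟨s, hs⟩ := (inferInstance : Algebra.FiniteType ℤ R).out
  refine Function.Injective.countable (f := fun (φ : R →+* S) (x : s) ↦ φ x.1) fun φ ψ e ↦ ?_
  have : φ.toIntAlgHom = ψ.toIntAlgHom := by
    refine AlgHom.ext_of_adjoin_eq_top hs fun x hx ↦ ?_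
    exact congrFun e ⟨x, hx⟩
  ext x
  exact congrArg (fun f ↦ f x) this

/-- Codes for affine schemes of finite type over the integers. -/
abbrev E : Type := Σ n : ℕ, Ideal (MvPolynomial (Fin n) ℤ)

instance : Countable E := by
  have := countable_mvPoly
  have := fun n : ℕ ↦ countable_ideal (MvPolynomial (Fin n) ℤ)
  infer_instance

/-- The ring of a code. -/
noncomputable def KR (e : E) : CommRingCat.{u} := .of (ULift.{u} (MvPolynomial (Fin e.1) ℤ ⧸ e.2))

instance (e : E) : Countable (KR.{u} e) := by
  have := countable_mvPoly e.1
  have : Countable (MvPolynomial (Fin e.1) ℤ ⧸ e.2) :=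
    Function.Surjective.countable (f := Ideal.Quotient.mk e.2) Ideal.Quotient.mk_surjective
  exact inferInstanceAs (Countable (ULift.{u} (MvPolynomial (Fin e.1) ℤ ⧸ e.2)))

instance (e : E) : Algebra.FiniteType ℤ (KR.{u} e) := by
  let f : MvPolynomial (Fin e.1) ℤ →+* KR.{u} e :=
    (ULift.ringEquiv.{0, u} (R := MvPolynomial (Fin e.1) ℤ ⧸ e.2)).symm.toRingHom.comp
      (Ideal.Quotient.mk e.2)
  let f' : MvPolynomial (Fin e.1) ℤ →ₐ[ℤ] KR.{u} e := { f with commutes' := fun r ↦ by simp }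
  exact Algebra.FiniteType.iff_quotient_mvPolynomial''.mpr ⟨e.1, f',
    ((ULift.ringEquiv.{0, u} (R := MvPolynomial (Fin e.1) ℤ ⧸ e.2)).symm.surjective.comp
      Ideal.Quotient.mk_surjective)⟩

/-- The scheme of a code. -/
noncomputable def K (e : E) : Scheme.{u} := Spec (KR.{u} e)

instance (e e' : E) : Countable (K.{u} e ⟶ K.{u} e') := by
  have := countable_ringHom (KR.{u} e') (KR.{u} e)
  refine Function.Surjective.countable
    (f := fun φ : KR.{u} e' →+* KR.{u} e ↦ (Spec.map (CommRingCat.ofHom φ) : K e ⟶ K e')) ?_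
  intro m
  obtain ⟨φ, hφ⟩ := Spec.map_surjective (R := KR.{u} e') (S := KR.{u} e) m
  exact ⟨φ.hom, hφ⟩

lemma exists_K {A : Scheme.{u}} [IsAffine A] (hA : FTZ A) : ∃ e, Nonempty (A ≅ K e) := by
  have := hA.finiteType (isAffineOpen_top A)
  obtain ⟨n, f, hf⟩ := Algebra.FiniteType.iff_quotient_mvPolynomial''.mp this
  refine ⟨⟨n, RingHom.ker f⟩, ⟨A.isoSpec ≪≫ Scheme.Spec.mapIso (Iso.op ?_)⟩⟩
  exact RingEquiv.toCommRingCatIso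
    (ULift.ringEquiv.trans (Ideal.quotientKerAlgEquivOfSurjective hf).toRingEquiv)

lemma exists_finite_cover {T : Scheme.{u}} [CompactSpace T] (P : T.Opens → Prop)
    (hP : ∀ x : T, ∃ U : T.Opens, P U ∧ x ∈ U) :
    ∃ (ι : Type u) (_ : Finite ι) (U : ι → T.Opens), (∀ i, P (U i)) ∧ ⨆ i, U i = ⊤ := by
  choose U hU hx using hP
  obtain ⟨t, ht⟩ := CompactSpace.elim_nhds_subcover (fun x ↦ (U x : Set T))
    (fun x ↦ (U x).2.mem_nhds (hx x))
  refine ⟨t, inferInstance, fun x ↦ U x, fun x ↦ hU x, ?_⟩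
  rw [eq_top_iff]
  intro x _
  have h : x ∈ ⋃ x ∈ t, (U x : Set T) := by rw [ht]; trivial
  obtain ⟨y, hy, hxy⟩ := Set.mem_iUnion₂.mp h
  exact TopologicalSpace.Opens.mem_iSup.mpr ⟨⟨y, hy⟩, hxy⟩

end CDF

namespace CDF

lemma exists_cover_K {T : Scheme.{u}} (hT : FTZ T) (P : T.Opens → Prop)
    (hP : ∀ x : T, ∃ U : T.Opens, (IsAffineOpen U ∧ P U) ∧ x ∈ U) :
    ∃ (ι : Type u) (U : ι → T.Opens) (e : E) (σ : ∀ i, (U i).toScheme ⟶ K.{u} e),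
      (∀ i, P (U i)) ∧ ⨆ i, U i = ⊤ ∧
      (∀ (Z : Scheme.{u}) (f : ∀ i, (U i).toScheme ⟶ Z), ∃ m : K e ⟶ Z, ∀ i, σ i ≫ m = f i) ∧
      (∀ (Z : Scheme.{u}) (m m' : K e ⟶ Z), (∀ i, σ i ≫ m = σ i ≫ m') → m = m') := by
  have := hT.compact
  obtain ⟨ι, hι, U, hU, hc⟩ := exists_finite_cover _ hP
  have : ∀ i, IsAffine (U i).toScheme := fun i ↦ (hU i).1
  have hA : FTZ (∐ fun i ↦ (U i).toScheme) := by
    have : Finite (sigmaOpenCover fun i ↦ (U i).toScheme).I₀ := hι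
    exact FTZ.of_cover (sigmaOpenCover _) fun i ↦ hT.opens (U i)
  obtain ⟨e, ⟨eA⟩⟩ := exists_K hA
  refine ⟨ι, U, e, fun i ↦ Sigma.ι (fun i ↦ (U i).toScheme) i ≫ eA.hom, fun i ↦ (hU i).2, hc,
    fun Z f ↦ ⟨eA.inv ≫ Sigma.desc f, fun i ↦ by simp⟩, fun Z m m' h ↦ ?_⟩
  rw [← cancel_epi eA.hom]
  refine Sigma.hom_ext _ _ fun i ↦ ?_
  simpa using h i

/-- `T` over `S₀` is presented by the given code. -/
structure Pres {S₀ : Scheme.{u}} {e0 e1 e2 : E} (γ : K e0 ⟶ S₀) (p q : K.{u} e2 ⟶ K e1)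
    (g : K e1 ⟶ K e0) (T : Over S₀) : Prop where
  ftz : FTZ T.left
  ex : ∃ π : K e1 ⟶ T.left, p ≫ π = q ≫ π ∧ g ≫ γ = π ≫ T.hom ∧
    ∀ (Z : Scheme.{u}) (f : K e1 ⟶ Z), p ≫ f = q ≫ f → ∃! m : T.left ⟶ Z, π ≫ m = f

lemma Pres.iso {S₀ : Scheme.{u}} {e0 e1 e2 : E} {γ : K e0 ⟶ S₀} {p q : K.{u} e2 ⟶ K e1}
    {g : K e1 ⟶ K e0} {T T' : Over S₀} (h : Pres γ p q g T) (h' : Pres γ p q g T') :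
    Nonempty (T ≅ T') := by
  obtain ⟨π, h1, h2, h3⟩ := h.ex
  obtain ⟨π', h1', h2', h3'⟩ := h'.ex
  obtain ⟨m, hm, -⟩ := h3 _ π' h1'
  obtain ⟨m', hm', -⟩ := h3' _ π h1
  have e1 : m ≫ m' = 𝟙 _ :=
    (h3 _ π h1).unique (by rw [reassoc_of% hm, hm']) (by simp)
  have e2 : m' ≫ m = 𝟙 _ :=
    (h3' _ π' h1').unique (by rw [reassoc_of% hm', hm]) (by simp)
  refine ⟨Over.isoMk ⟨m, m', e1, e2⟩ ?_⟩
  refine (h3 _ (π ≫ T.hom) (by rw [reassoc_of% h1])).unique ?_ rfl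
  dsimp only
  rw [reassoc_of% hm, ← h2', h2]

lemma exists_pres {S₀ : Scheme.{u}} {e0 : E} (γ : K e0 ⟶ S₀) (T : Over S₀) (hT : FTZ T.left)
    (hγ : ∀ x : T.left, ∃ U : T.left.Opens,
      (IsAffineOpen U ∧ ∃ g : U.toScheme ⟶ K e0, g ≫ γ = U.ι ≫ T.hom) ∧ x ∈ U) :
    ∃ (e1 e2 : E) (p q : K.{u} e2 ⟶ K e1) (g : K e1 ⟶ K e0), Pres γ p q g T := by
  obtain ⟨ι, U, e1, σ, hU, hc, h1, h2⟩ := exists_cover_K hT _ hγ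
  choose g hg using hU
  obtain ⟨π, hπ⟩ := h1 _ (fun i ↦ (U i).ι)
  obtain ⟨g', hg'⟩ := h1 _ g
  have hK : FTZ (K.{u} e1) := FTZ.spec (KR.{u} e1)
  have := hK.hom π
  have := hK.qc π
  have hQ : FTZ (pullback π π) := hK.of_hom (pullback.fst π π)
  obtain ⟨ι', U', e2, σ', -, hc', h1', h2'⟩ := exists_cover_K hQ (fun _ ↦ True) (by
    intro x
    obtain ⟨V, hV, hx, -⟩ := (Scheme.isBasis_affineOpens (pullback π π)).exists_subset_of_mem_open
      (show x ∈ (Set.univ : Set (pullback π π :)) from trivial) isOpen_univ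
    obtain ⟨V, hV, rfl⟩ := hV
    exact ⟨V, ⟨hV, trivial⟩, hx⟩)
  obtain ⟨ω, hω⟩ := h1' _ (fun i ↦ (U' i).ι)
  have hωe : ∀ (Z : Scheme.{u}) (m m' : pullback π π ⟶ Z), ω ≫ m = ω ≫ m' → m = m' := by
    intro Z m m' h
    have hh : ∀ i, (U' i).ι ≫ m = (U' i).ι ≫ m' := by
      intro i
      rw [← hω, Category.assoc, Category.assoc, h]
    exact ((pullback π π :).openCoverOfIsOpenCover U' hc').hom_ext _ _ fun i ↦ hh i
  let 𝒰 := T.left.openCoverOfIsOpenCover U hc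
  refine ⟨e1, e2, ω ≫ pullback.fst π π, ω ≫ pullback.snd π π, g', hT, π, ?_, ?_, ?_⟩
  · rw [Category.assoc, pullback.condition, Category.assoc]
  · refine h2 _ _ _ fun i ↦ ?_
    rw [reassoc_of% hg', hg, reassoc_of% hπ]
  · intro Z f hf
    have hf' : pullback.fst π π ≫ f = pullback.snd π π ≫ f := hωe _ _ _ (by simpa using hf)
    obtain ⟨s', hs', hs2⟩ : ∃ s' : ∀ i : 𝒰.I₀, 𝒰.X i ⟶ K e1, (∀ i, s' i ≫ π = 𝒰.f i) ∧
      ∀ (m m' : K e1 ⟶ Z), (∀ i, s' i ≫ m = s' i ≫ m') → m = m' := ⟨σ, hπ, h2 Z⟩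
    have huniq : ∀ m : T.left ⟶ Z, π ≫ m = f → ∀ i, 𝒰.f i ≫ m = s' i ≫ f := by
      intro m hm i
      rw [← hs', Category.assoc, hm]
    refine ⟨𝒰.glueMorphisms (fun i ↦ s' i ≫ f) ?_, ?_, ?_⟩
    · intro i j
      obtain ⟨L, hL1, hL2⟩ : ∃ L, L ≫ pullback.fst π π = pullback.fst (𝒰.f i) (𝒰.f j) ≫ s' i ∧
          L ≫ pullback.snd π π = pullback.snd (𝒰.f i) (𝒰.f j) ≫ s' j :=
        ⟨pullback.lift (pullback.fst (𝒰.f i) (𝒰.f j) ≫ s' i)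
          (pullback.snd (𝒰.f i) (𝒰.f j) ≫ s' j) (by
          rw [Category.assoc, Category.assoc, hs', hs', pullback.condition]),
          pullback.lift_fst _ _ _, pullback.lift_snd _ _ _⟩
      rw [← Category.assoc, ← Category.assoc, ← hL1, ← hL2, Category.assoc, Category.assoc, hf']
    · refine hs2 _ _ fun i ↦ ?_
      rw [reassoc_of% hs', Scheme.Cover.ι_glueMorphisms]
    · intro m hm
      refine 𝒰.hom_ext _ _ fun i ↦ ?_
      rw [huniq m hm, Scheme.Cover.ι_glueMorphisms]

/-- Countably many isomorphism classes of finite type schemes over a finite type scheme. -/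
lemma exists_enum {S₀ : Scheme.{u}} (hS : FTZ S₀) :
    ∃ F : ℕ → Over S₀, (∀ n, FTZ (F n).left) ∧
      ∀ T : Over S₀, FTZ T.left → ∃ n, Nonempty (F n ≅ T) := by
  obtain ⟨ι, U, e0, σ, -, hc, h1, h2⟩ := exists_cover_K hS (fun _ ↦ True) (by
    intro x
    obtain ⟨V, hV, hx, -⟩ := S₀.isBasis_affineOpens.exists_subset_of_mem_open
      (show x ∈ (Set.univ : Set S₀) from trivial) isOpen_univ
    obtain ⟨V, hV, rfl⟩ := hV
    exact ⟨V, ⟨hV, trivial⟩, hx⟩)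
  obtain ⟨γ, hγ⟩ := h1 _ (fun i ↦ (U i).ι)
  let Code := Σ (e1 e2 : E), ((K.{u} e2 ⟶ K.{u} e1) × (K.{u} e2 ⟶ K.{u} e1)) ×
    (K.{u} e1 ⟶ K.{u} e0)
  have : Countable Code := inferInstance
  classical
  let G : Option Code → Over S₀ := fun c ↦ match c with
    | none => Over.mk (𝟙 S₀)
    | some ⟨e1, e2, ⟨p, q⟩, g⟩ =>
      if h : ∃ T : Over S₀, Pres γ p q g T then h.choose else Over.mk (𝟙 S₀)
  have hG : ∀ c, FTZ (G c).left := by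
    intro c
    rcases c with _ | ⟨e1, e2, ⟨p, q⟩, g⟩
    · exact hS
    · by_cases h : ∃ T : Over S₀, Pres γ p q g T
      · have : G (some ⟨e1, e2, ⟨p, q⟩, g⟩) = h.choose := dif_pos h
        rw [this]
        exact h.choose_spec.ftz
      · have : G (some ⟨e1, e2, ⟨p, q⟩, g⟩) = Over.mk (𝟙 S₀) := dif_neg h
        rw [this]
        exact hS
  obtain ⟨φ, hφ⟩ := exists_surjective_nat (Option Code)
  refine ⟨fun n ↦ G (φ n), fun n ↦ hG _, fun T hT ↦ ?_⟩
  obtain ⟨e1, e2, p, q, g, hP⟩ := exists_pres γ T hT (by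
    intro x
    obtain ⟨i, hi⟩ := TopologicalSpace.Opens.mem_iSup.mp
      (show T.hom x ∈ ⨆ i, U i by rw [hc]; trivial)
    obtain ⟨V, hV, hx, hVU⟩ := T.left.isBasis_affineOpens.exists_subset_of_mem_open
      (show x ∈ ((T.hom ⁻¹ᵁ U i : T.left.Opens) : Set T.left) from hi) (T.hom ⁻¹ᵁ U i).2
    obtain ⟨V, hV, rfl⟩ := hV
    refine ⟨V, ⟨hV, T.hom.resLE (U i) V hVU ≫ σ i, ?_⟩, hx⟩
    rw [Category.assoc, hγ]
    exact Scheme.Hom.resLE_comp_ι _ _)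
  obtain ⟨n, hn⟩ := hφ (some ⟨e1, e2, ⟨p, q⟩, g⟩)
  have h : ∃ T : Over S₀, Pres γ p q g T := ⟨T, hP⟩
  have : G (some ⟨e1, e2, ⟨p, q⟩, g⟩) = h.choose := dif_pos h
  refine ⟨n, ?_⟩
  dsimp only
  rw [hn, this]
  exact h.choose_spec.iso hP

end CDF

namespace CDF

lemma appLE_bij {N T : Scheme.{u}} (k : N ⟶ T) [IsOpenImmersion k] (U : T.Opens)
    (hU : k.opensRange = U) (h : ⊤ ≤ k ⁻¹ᵁ U) : Function.Bijective (k.appLE U ⊤ h) := by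
  have hU' : U = k ''ᵁ ⊤ := by rw [← hU, Scheme.Hom.image_top_eq_opensRange]
  subst hU'
  have := k.appIso_hom' ⊤
  rw [← this]
  exact ConcreteCategory.bijective_of_isIso _

/-- index type for the canonical system approximating `B` -/
structure Ix {B B₀ : Scheme.{u}} (π : B ⟶ B₀) (F : ℕ → Over B₀) : Type u where
  n : ℕ
  b : B ⟶ (F n).left
  w : b ≫ (F n).hom = π
  aff : IsAffineHom (F n).hom
  inj : ∀ V : B₀.Opens, IsAffineOpen V →
    Function.Injective (b.appLE ((F n).hom ⁻¹ᵁ V) (π ⁻¹ᵁ V) (le_pre w V))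

instance {B B₀ : Scheme.{u}} (π : B ⟶ B₀) (F : ℕ → Over B₀) : Category.{u} (Ix π F) where
  Hom i j := {h : (F i.n).left ⟶ (F j.n).left // h ≫ (F j.n).hom = (F i.n).hom ∧ i.b ≫ h = j.b}
  id i := ⟨𝟙 _, by simp, by simp⟩
  comp {i j k} f g := ⟨f.1 ≫ g.1, by rw [Category.assoc, g.2.1, f.2.1], by
    rw [← Category.assoc, f.2.2, g.2.2]⟩

lemma ix_ext {B B₀ : Scheme.{u}} {π : B ⟶ B₀} {F : ℕ → Over B₀} {i j : Ix π F} (f g : i ⟶ j) :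
    f = g := by
  refine Subtype.ext ?_
  have hi := i.w
  have hj := j.w
  have ai := i.inj
  have aj := j.aff
  obtain ⟨f, f1, f2⟩ := f
  obtain ⟨g, g1, g2⟩ := g
  refine hom_ext_cover (F i.n).hom _ _ fun V hV ↦ ?_
  refine hom_ext_affine (hV.preimage (F j.n).hom) _ _ (top_le_pre _ V f1) (top_le_pre _ V g1) ?_
  have e1 : (F i.n).hom ⁻¹ᵁ V ≤ f ⁻¹ᵁ ((F j.n).hom ⁻¹ᵁ V) := le_pre f1 V
  have e2 : (F i.n).hom ⁻¹ᵁ V ≤ g ⁻¹ᵁ ((F j.n).hom ⁻¹ᵁ V) := le_pre g1 V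
  have e3 : ⊤ ≤ ((F i.n).hom ⁻¹ᵁ V).ι ⁻¹ᵁ ((F i.n).hom ⁻¹ᵁ V) := by
    rw [Scheme.Opens.ι_preimage_self]
  rw [← Scheme.Hom.appLE_comp_appLE _ _ _ _ _ e1 e3, ← Scheme.Hom.appLE_comp_appLE _ _ _ _ _ e2 e3]
  congr 1
  ext s
  apply ai V hV
  rw [← ConcreteCategory.comp_apply, ← ConcreteCategory.comp_apply]
  rw [Scheme.Hom.appLE_comp_appLE, Scheme.Hom.appLE_comp_appLE]
  simp only [f2, g2]

lemma exists_ix {B B₀ : Scheme.{u}} (hB₀ : FTZ B₀) (π : B ⟶ B₀) [IsAffineHom π]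
    (F : ℕ → Over B₀) (hF : ∀ T : Over B₀, FTZ T.left → ∃ n, Nonempty (F n ≅ T))
    {T : Scheme.{u}} (p : T ⟶ B₀) [IsAffineHom p] [LocallyOfFiniteType p] (b : B ⟶ T)
    (hb : b ≫ p = π) : ∃ (i : Ix π F) (h : (F i.n).left ⟶ T), h ≫ p = (F i.n).hom ∧
      i.b ≫ h = b := by
  have hT : FTZ T := hB₀.of_hom p
  have := hT.noeth
  have : IsAffineHom (b ≫ p) := by rwa [hb]
  have : IsAffineHom b := IsAffineHom.of_comp b p
  have hI : FTZ b.image := hT.of_hom b.imageι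
  obtain ⟨n, ⟨e⟩⟩ := hF (Over.mk (b.imageι ≫ p)) hI
  obtain ⟨e1, e2, h1, h2, h3⟩ : ∃ (e1 : (F n).left ⟶ b.image) (e2 : b.image ⟶ (F n).left),
      e1 ≫ e2 = 𝟙 _ ∧ e2 ≫ e1 = 𝟙 _ ∧ e1 ≫ b.imageι ≫ p = (F n).hom :=
    ⟨e.hom.left, e.inv.left, by rw [← Over.comp_left]; simp, by rw [← Over.comp_left]; simp,
      Over.w e.hom⟩
  have i1 : IsIso e1 := ⟨e2, h1, h2⟩
  have i2 : IsIso e2 := ⟨e1, h2, h1⟩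
  have w : (b.toImage ≫ e2) ≫ (F n).hom = π := by
    rw [← h3, Category.assoc, reassoc_of% h2, Scheme.Hom.toImage_imageι_assoc, hb]
  refine ⟨⟨n, b.toImage ≫ e2, w, ?_, ?_⟩, e1 ≫ b.imageι, ?_, ?_⟩
  · rw [← h3]; infer_instance
  · intro V hV
    have w' : b.toImage ≫ b.imageι ≫ p = π := by rw [Scheme.Hom.toImage_imageι_assoc, hb]
    have w2 : e2 ≫ (F n).hom = b.imageι ≫ p := by
      rw [← h3, reassoc_of% h2]
    have hle : π ⁻¹ᵁ V ≤ b.toImage ⁻¹ᵁ ((b.imageι ≫ p) ⁻¹ᵁ V) := le_pre w' V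
    rw [← Scheme.Hom.appLE_comp_appLE _ _ _ _ _ (le_pre w2 V) hle]
    have inj1 : Function.Injective (b.toImage.appLE ((b.imageι ≫ p) ⁻¹ᵁ V) (π ⁻¹ᵁ V) hle) := by
      have := b.toImage_app_injective ⟨p ⁻¹ᵁ V, hV.preimage p⟩
      have hh : π ⁻¹ᵁ V = b.toImage ⁻¹ᵁ (b.imageι ⁻¹ᵁ (p ⁻¹ᵁ V)) := by rw [← w']; rfl
      have key : ∀ U (hU : U = b.toImage ⁻¹ᵁ (b.imageι ⁻¹ᵁ (p ⁻¹ᵁ V))),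
          Function.Injective (b.toImage.appLE (b.imageι ⁻¹ᵁ (p ⁻¹ᵁ V)) U hU.le) := by
        rintro _ rfl
        rw [Scheme.Hom.appLE_eq_app]
        exact this
      exact key _ hh
    have inj2 : Function.Injective (e2.appLE ((F n).hom ⁻¹ᵁ V) ((b.imageι ≫ p) ⁻¹ᵁ V)
        (le_pre w2 V)) := by
      have hh : (b.imageι ≫ p) ⁻¹ᵁ V = e2 ⁻¹ᵁ ((F n).hom ⁻¹ᵁ V) := by rw [← w2]; rfl
      have key : ∀ U (hU : U = e2 ⁻¹ᵁ ((F n).hom ⁻¹ᵁ V)),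
          Function.Injective (e2.appLE ((F n).hom ⁻¹ᵁ V) U hU.le) := by
        rintro _ rfl
        rw [Scheme.Hom.appLE_eq_app]
        exact (ConcreteCategory.bijective_of_isIso _).1
      exact key _ hh
    intro x y hxy
    rw [ConcreteCategory.comp_apply, ConcreteCategory.comp_apply] at hxy
    exact inj2 (inj1 hxy)
  · rw [Category.assoc]; exact h3
  · rw [Category.assoc, reassoc_of% h2, Scheme.Hom.toImage_imageι]

lemma pb_aff {T T' B₀ : Scheme.{u}} (p : T ⟶ B₀) (q : T' ⟶ B₀) [IsAffineHom p] [IsAffineHom q]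
    [LocallyOfFiniteType p] [LocallyOfFiniteType q] :
    IsAffineHom (pullback.fst p q ≫ p) ∧ LocallyOfFiniteType (pullback.fst p q ≫ p) := by
  have := isAffineHom_isStableUnderBaseChange.{u}
  have : IsAffineHom (pullback.fst p q) :=
    this.of_isPullback (IsPullback.of_hasPullback p q).flip ‹_›
  exact ⟨inferInstance, inferInstance⟩

lemma ix_cofiltered {B B₀ : Scheme.{u}} (hB₀ : FTZ B₀) (π : B ⟶ B₀) [IsAffineHom π]
    (F : ℕ → Over B₀) (hFT : ∀ n, FTZ (F n).left)
    (hF : ∀ T : Over B₀, FTZ T.left → ∃ n, Nonempty (F n ≅ T)) :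
    IsCofiltered (Ix π F) := by
  have : IsCofilteredOrEmpty (Ix π F) := by
    constructor
    · intro i j
      have := i.aff
      have := j.aff
      have := (hFT i.n).hom (F i.n).hom
      have := (hFT j.n).hom (F j.n).hom
      obtain ⟨_, _⟩ := pb_aff (F i.n).hom (F j.n).hom
      obtain ⟨k, h, h1, h2⟩ := exists_ix hB₀ π F hF
        (pullback.fst (F i.n).hom (F j.n).hom ≫ (F i.n).hom)
        (pullback.lift i.b j.b (i.w.trans j.w.symm)) (by rw [pullback.lift_fst_assoc, i.w])
      refine ⟨k, ⟨h ≫ pullback.fst _ _, ?_, ?_⟩, ⟨h ≫ pullback.snd _ _, ?_, ?_⟩, trivial⟩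
      · rw [Category.assoc]; exact h1
      · rw [← Category.assoc, h2]; exact pullback.lift_fst _ _ _
      · rw [Category.assoc, ← pullback.condition]; exact h1
      · rw [← Category.assoc, h2]; exact pullback.lift_snd _ _ _
    · intro i j f g
      exact ⟨i, 𝟙 i, by rw [ix_ext f g]⟩
  obtain ⟨i, -⟩ := exists_ix hB₀ π F hF (𝟙 B₀) π (by simp)
  exact { nonempty := ⟨i⟩ }

lemma ix_surj {B B₀ : Scheme.{u}} (hB₀ : FTZ B₀) (π : B ⟶ B₀) [IsAffineHom π]
    (F : ℕ → Over B₀) (hF : ∀ T : Over B₀, FTZ T.left → ∃ n, Nonempty (F n ≅ T))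
    (V : B₀.Opens) (f : Γ(B, π ⁻¹ᵁ V)) : ∃ (i : Ix π F) (a : _),
      i.b.appLE ((F i.n).hom ⁻¹ᵁ V) (π ⁻¹ᵁ V) (le_pre i.w V) a = f := by
  have := hB₀.noeth
  have hV : ⊤ ≤ (π ⁻¹ᵁ V).ι ⁻¹ᵁ (π ⁻¹ᵁ V) := by rw [Scheme.Opens.ι_preimage_self]
  let f' : Γ(π ⁻¹ᵁ V, ⊤) := (π ⁻¹ᵁ V).ι.appLE _ ⊤ hV f
  let n : (π ⁻¹ᵁ V).toScheme ⟶ 𝔸(PUnit; V) := AffineSpace.homOfVector (π ∣_ V) (fun _ ↦ f')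
  obtain ⟨T, p, b, k, h1, h2, h3, h4, h5⟩ := ext_all π V (𝔸(PUnit; V) ↘ V.toScheme) n
    (AffineSpace.homOfVector_over _ _)
  obtain ⟨i, h, hh, hb⟩ := exists_ix hB₀ π F hF p b h3
  have : IsOpenImmersion k := MorphismProperty.of_isPullback h4.flip inferInstance
  have hk : k.opensRange = p ⁻¹ᵁ V := by
    have := opensRange_of_isPullback h4.flip
    rwa [Scheme.Opens.opensRange_ι] at this
  have hkV : ⊤ ≤ k ⁻¹ᵁ (p ⁻¹ᵁ V) := by rw [← hk, Scheme.Hom.preimage_opensRange]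
  obtain ⟨c, hc⟩ := (appLE_bij k _ hk hkV).2 (AffineSpace.coord V.toScheme PUnit.unit)
  refine ⟨i, h.appLE (p ⁻¹ᵁ V) _ (le_pre hh V) c, ?_⟩
  rw [← ConcreteCategory.comp_apply, Scheme.Hom.appLE_comp_appLE]
  simp only [hb]
  apply (appLE_bij (π ⁻¹ᵁ V).ι (π ⁻¹ᵁ V) (Scheme.Opens.opensRange_ι _) hV).1
  change _ = f'
  rw [← ConcreteCategory.comp_apply, Scheme.Hom.appLE_comp_appLE]
  simp only [← h5]
  rw [← Scheme.Hom.appLE_comp_appLE n k _ ⊤ ⊤ hkV le_rfl, ConcreteCategory.comp_apply, hc]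
  have : n.appLE ⊤ ⊤ le_rfl = n.appTop := Scheme.Hom.appLE_eq_app _
  rw [this]
  exact AffineSpace.homOfVector_appTop_coord _ _ _

/-- A cofiltered limit of finite type `ℤ`-schemes with affine transition maps. -/
structure Sys where
  I : Type u
  cat : Category.{u} I
  cof : IsCofiltered I
  D : I ⥤ Scheme.{u}
  c : Cone D
  hc : IsLimit c
  aff : ∀ {i j : I} (f : i ⟶ j), IsAffineHom (D.map f)
  ftz : ∀ i, FTZ (D.obj i)

attribute [instance] Sys.cat Sys.cof Sys.aff

lemma exists_sys {B B₀ : Scheme.{u}} (hB₀ : FTZ B₀) (π : B ⟶ B₀) [IsAffineHom π] :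
    ∃ σ : Sys.{u}, σ.c.pt = B := by
  obtain ⟨F, hFT, hF⟩ := exists_enum hB₀
  have cof := ix_cofiltered hB₀ π F hFT hF
  have := cof.nonempty
  let D : Ix π F ⥤ Scheme.{u} :=
    { obj i := (F i.n).left
      map f := f.1
      map_id _ := rfl
      map_comp _ _ := rfl }
  let c : Cone D :=
    { pt := B
      π :=
        { app i := i.b
          naturality {i j} f := by
            dsimp
            rw [Category.id_comp]
            exact f.2.2.symm } }
  have afp : ∀ i : Ix π F, IsAffineHom (F i.n).hom := fun i ↦ i.aff
  have surj := ix_surj hB₀ π F hF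
  have ex := fun (s : Cone D) ↦ limit_exists π D (fun i ↦ i.b) (fun f ↦ f.2.2)
    (fun i ↦ (F i.n).hom) (fun f ↦ f.2.1) (fun i ↦ i.w) (fun V _ f ↦ surj V f)
    (fun V hV i ↦ i.inj V hV) (fun i ↦ s.π.app i) (fun f ↦ s.w f)
  have uq := fun {W : Scheme.{u}} (m m' : W ⟶ B) (e) ↦ limit_uniq π (fun i : Ix π F ↦ (F i.n).left)
    (fun i ↦ i.b)
    (fun i ↦ (F i.n).hom) (fun i ↦ i.w) (fun V _ f ↦ surj V f) m m' e
  refine ⟨⟨Ix π F, inferInstance, cof, D, c,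
    { lift s := (ex s).choose
      fac s j := (ex s).choose_spec j
      uniq s m hm := uq _ _ fun i ↦ (hm i).trans ((ex s).choose_spec i).symm }, ?_, fun i ↦ hFT _⟩, rfl⟩
  intro i j f
  have : IsAffineHom (f.1 ≫ (F j.n).hom) := by rw [f.2.1]; exact i.aff
  have := j.aff
  exact IsAffineHom.of_comp f.1 (F j.n).hom

end CDF

namespace CDF

lemma loft_qc_of_isPullback {P X Y Z : Scheme.{u}} {a : P ⟶ X} {b : P ⟶ Y} {f : X ⟶ Z}
    {g : Y ⟶ Z} (h : IsPullback a b f g) [LocallyOfFiniteType f] [QuasiCompact f] :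
    LocallyOfFiniteType b ∧ QuasiCompact b := by
  rw [← h.isoPullback_hom_snd]
  constructor <;> infer_instance

lemma ftz_of_isPullback {P X Y Z : Scheme.{u}} {a : P ⟶ X} {b : P ⟶ Y} {f : X ⟶ Z}
    {g : Y ⟶ Z} (h : IsPullback a b f g) [LocallyOfFiniteType f] [QuasiCompact f]
    (hY : FTZ Y) : FTZ P := by
  obtain ⟨_, _⟩ := loft_qc_of_isPullback h
  exact hY.of_hom b

namespace Sys

/-- transition maps of the base-changed system -/
noncomputable def pbm (σ : Sys.{u}) (i : σ.I) {P : Scheme.{u}} (p : P ⟶ σ.D.obj i) {j k : Over i}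
    (f : j ⟶ k) : pullback p (σ.D.map j.hom) ⟶ pullback p (σ.D.map k.hom) :=
  pullback.lift (pullback.fst _ _) (pullback.snd _ _ ≫ σ.D.map f.left) (by
    rw [Category.assoc, ← σ.D.map_comp, Over.w, pullback.condition])

lemma pbm_fst (σ : Sys.{u}) (i : σ.I) {P : Scheme.{u}} (p : P ⟶ σ.D.obj i) {j k : Over i}
    (f : j ⟶ k) : σ.pbm i p f ≫ pullback.fst p (σ.D.map k.hom) = pullback.fst _ _ :=
  pullback.lift_fst _ _ _

lemma pbm_snd (σ : Sys.{u}) (i : σ.I) {P : Scheme.{u}} (p : P ⟶ σ.D.obj i) {j k : Over i}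
    (f : j ⟶ k) : σ.pbm i p f ≫ pullback.snd p (σ.D.map k.hom) =
      pullback.snd _ _ ≫ σ.D.map f.left :=
  pullback.lift_snd _ _ _

/-- the base-changed diagram -/
noncomputable def pbD (σ : Sys.{u}) (i : σ.I) {P : Scheme.{u}} (p : P ⟶ σ.D.obj i) :
    Over i ⥤ Scheme.{u} where
  obj j := pullback p (σ.D.map j.hom)
  map f := σ.pbm i p f
  map_id j := by
    refine pullback.hom_ext ?_ ?_
    · rw [pbm_fst, Category.id_comp]
    · rw [pbm_snd, Category.id_comp, Over.id_left, σ.D.map_id]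
      exact Category.comp_id _
  map_comp {j k l} f g := by
    refine pullback.hom_ext ?_ ?_
    · rw [Category.assoc, pbm_fst, pbm_fst, pbm_fst]
    · rw [Category.assoc, pbm_snd, pbm_snd, ← Category.assoc, pbm_snd,
        Over.comp_left, σ.D.map_comp, Category.assoc]

/-- first projection -/
noncomputable def pbF (σ : Sys.{u}) (i : σ.I) {P : Scheme.{u}} (p : P ⟶ σ.D.obj i) (j : Over i) :
    (σ.pbD i p).obj j ⟶ P := pullback.fst p (σ.D.map j.hom)

/-- second projection -/
noncomputable def pbS (σ : Sys.{u}) (i : σ.I) {P : Scheme.{u}} (p : P ⟶ σ.D.obj i) (j : Over i) :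
    (σ.pbD i p).obj j ⟶ σ.D.obj j.left := pullback.snd p (σ.D.map j.hom)

lemma pb_sq (σ : Sys.{u}) (i : σ.I) {P : Scheme.{u}} (p : P ⟶ σ.D.obj i) (j : Over i) :
    IsPullback (σ.pbF i p j) (σ.pbS i p j) p (σ.D.map j.hom) :=
  IsPullback.of_hasPullback _ _

lemma pbD_fst (σ : Sys.{u}) (i : σ.I) {P : Scheme.{u}} (p : P ⟶ σ.D.obj i) {j k : Over i}
    (f : j ⟶ k) : (σ.pbD i p).map f ≫ σ.pbF i p k = σ.pbF i p j :=
  pullback.lift_fst _ _ _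

lemma pbD_snd (σ : Sys.{u}) (i : σ.I) {P : Scheme.{u}} (p : P ⟶ σ.D.obj i) {j k : Over i}
    (f : j ⟶ k) : (σ.pbD i p).map f ≫ σ.pbS i p k = σ.pbS i p j ≫ σ.D.map f.left :=
  pullback.lift_snd _ _ _

lemma pbD_aff (σ : Sys.{u}) (i : σ.I) {P : Scheme.{u}} (p : P ⟶ σ.D.obj i) {j k : Over i}
    (f : j ⟶ k) : IsAffineHom ((σ.pbD i p).map f) := by
  have h : IsPullback ((σ.pbD i p).map f) (σ.pbS i p j)
      (σ.pbS i p k) (σ.D.map f.left) := by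
    refine IsPullback.of_right ?_ (pbD_snd σ i p f) (σ.pb_sq i p k)
    rw [pbD_fst, ← σ.D.map_comp, Over.w]
    exact σ.pb_sq i p j
  have := isAffineHom_isStableUnderBaseChange.{u}
  exact this.of_isPullback h.flip inferInstance

/-- The cone components of the base-changed system. -/
noncomputable def pbp (σ : Sys.{u}) (i : σ.I) {P Z : Scheme.{u}} {p : P ⟶ σ.D.obj i} {g : Z ⟶ P}
    {z : Z ⟶ σ.c.pt} (h : IsPullback g z p (σ.c.π.app i)) (j : Over i) :
    Z ⟶ (σ.pbD i p).obj j :=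
  (σ.pb_sq i p j).lift g (z ≫ σ.c.π.app j.left) (by rw [Category.assoc, σ.c.w, h.w])

lemma pbp_fst (σ : Sys.{u}) (i : σ.I) {P Z : Scheme.{u}} {p : P ⟶ σ.D.obj i} {g : Z ⟶ P}
    {z : Z ⟶ σ.c.pt} (h : IsPullback g z p (σ.c.π.app i)) (j : Over i) :
    σ.pbp i h j ≫ σ.pbF i p j = g :=
  (σ.pb_sq i p j).lift_fst _ _ _

lemma pbp_snd (σ : Sys.{u}) (i : σ.I) {P Z : Scheme.{u}} {p : P ⟶ σ.D.obj i} {g : Z ⟶ P}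
    {z : Z ⟶ σ.c.pt} (h : IsPullback g z p (σ.c.π.app i)) (j : Over i) :
    σ.pbp i h j ≫ σ.pbS i p j = z ≫ σ.c.π.app j.left :=
  (σ.pb_sq i p j).lift_snd _ _ _

lemma pbp_nat (σ : Sys.{u}) (i : σ.I) {P Z : Scheme.{u}} {p : P ⟶ σ.D.obj i} {g : Z ⟶ P}
    {z : Z ⟶ σ.c.pt} (h : IsPullback g z p (σ.c.π.app i)) {j k : Over i} (f : j ⟶ k) :
    σ.pbp i h k = σ.pbp i h j ≫ (σ.pbD i p).map f := by
  refine (σ.pb_sq i p k).hom_ext ?_ ?_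
  · rw [Category.assoc, pbD_fst, pbp_fst, pbp_fst]
  · have e := pbD_snd σ i p f
    have e1 := pbp_snd σ i h j
    have e2 := pbp_snd σ i h k
    calc σ.pbp i h k ≫ σ.pbS i p k = z ≫ σ.c.π.app k.left := e2
      _ = z ≫ σ.c.π.app j.left ≫ σ.D.map f.left := by rw [σ.c.w]
      _ = (z ≫ σ.c.π.app j.left) ≫ σ.D.map f.left := (Category.assoc _ _ _).symm
      _ = (σ.pbp i h j ≫ σ.pbS i p j) ≫ σ.D.map f.left := by rw [e1]
      _ = σ.pbp i h j ≫ σ.pbS i p j ≫ σ.D.map f.left := Category.assoc _ _ _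
      _ = σ.pbp i h j ≫ (σ.pbD i p).map f ≫ σ.pbS i p k := by rw [e]
      _ = _ := (Category.assoc _ _ _).symm

/-- The cone of the base-changed system. -/
noncomputable def pbC (σ : Sys.{u}) (i : σ.I) {P Z : Scheme.{u}} {p : P ⟶ σ.D.obj i} {g : Z ⟶ P}
    {z : Z ⟶ σ.c.pt} (h : IsPullback g z p (σ.c.π.app i)) : Cone (σ.pbD i p) where
  pt := Z
  π :=
    { app j := σ.pbp i h j
      naturality {j k} f := (Category.id_comp _).trans (pbp_nat σ i h f) }

lemma pbC_fst (σ : Sys.{u}) (i : σ.I) {P Z : Scheme.{u}} {p : P ⟶ σ.D.obj i} {g : Z ⟶ P}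
    {z : Z ⟶ σ.c.pt} (h : IsPullback g z p (σ.c.π.app i)) (j : Over i) :
    (σ.pbC i h).π.app j ≫ σ.pbF i p j = g :=
  pbp_fst σ i h j

lemma pbC_snd (σ : Sys.{u}) (i : σ.I) {P Z : Scheme.{u}} {p : P ⟶ σ.D.obj i} {g : Z ⟶ P}
    {z : Z ⟶ σ.c.pt} (h : IsPullback g z p (σ.c.π.app i)) (j : Over i) :
    (σ.pbC i h).π.app j ≫ σ.pbS i p j = z ≫ σ.c.π.app j.left :=
  pbp_snd σ i h j

lemma cone_snd (σ : Sys.{u}) (i : σ.I) {P W : Scheme.{u}} {p : P ⟶ σ.D.obj i}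
    {j k : Over i} (f : j ⟶ k) (a : W ⟶ (σ.pbD i p).obj j) (b : W ⟶ (σ.pbD i p).obj k)
    (hab : a ≫ (σ.pbD i p).map f = b) :
    b ≫ σ.pbS i p k = (a ≫ σ.pbS i p j) ≫ σ.D.map f.left := by
  have e := pbD_snd σ i p f
  subst hab
  calc (a ≫ (σ.pbD i p).map f) ≫ σ.pbS i p k = a ≫ (σ.pbD i p).map f ≫ σ.pbS i p k :=
        Category.assoc _ _ _
    _ = a ≫ σ.pbS i p j ≫ σ.D.map f.left := by rw [e]
    _ = _ := (Category.assoc _ _ _).symm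

lemma pbC_isLimit (σ : Sys.{u}) (i : σ.I) {P Z : Scheme.{u}} {p : P ⟶ σ.D.obj i} {g : Z ⟶ P}
    {z : Z ⟶ σ.c.pt} (h : IsPullback g z p (σ.c.π.app i)) : Nonempty (IsLimit (σ.pbC i h)) := by
  let hw : IsLimit (σ.c.whisker (Over.forget i)) :=
    (Functor.Initial.isLimitWhiskerEquiv (Over.forget i) σ.c).symm σ.hc
  let s' : Cone (σ.pbD i p) → Cone (Over.forget i ⋙ σ.D) := fun s ↦
    { pt := s.pt
      π :=
        { app j := s.π.app j ≫ σ.pbS i p j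
          naturality {j k} f := (Category.id_comp _).trans (σ.cone_snd i f _ _ (s.w f)) } }
  have e1 : ∀ s : Cone (σ.pbD i p), ∀ j : Over i, s.π.app j ≫ σ.pbF i p j =
      s.π.app (Over.mk (𝟙 i)) ≫ σ.pbF i p _ := by
    intro s j
    rw [← s.w (Over.mkIdTerminal.from j), Category.assoc, pbD_fst]
  have hl : ∀ s : Cone (σ.pbD i p), ∀ j : Over i, hw.lift (s' s) ≫ σ.c.π.app j.left =
      s.π.app j ≫ σ.pbS i p j := fun s j ↦ hw.fac (s' s) j
  have ex : ∀ s : Cone (σ.pbD i p), ∃ m : s.pt ⟶ Z,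
      m ≫ g = s.π.app (Over.mk (𝟙 i)) ≫ σ.pbF i p _ ∧ m ≫ z = hw.lift (s' s) := by
    intro s
    have w : (s.π.app (Over.mk (𝟙 i)) ≫ σ.pbF i p _) ≫ p =
        hw.lift (s' s) ≫ σ.c.π.app i := by
      have := hl s (Over.mk (𝟙 i))
      refine Eq.trans ?_ this.symm
      rw [Category.assoc, (σ.pb_sq i p _).w]
      congr 1
      exact (congrArg _ (σ.D.map_id i)).trans (Category.comp_id _)
    exact ⟨h.lift _ _ w, h.lift_fst _ _ w, h.lift_snd _ _ w⟩
  choose m hm1 hm2 using ex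
  refine ⟨⟨m, ?_, ?_⟩⟩
  · intro s j
    refine (σ.pb_sq i p j).hom_ext ?_ ?_
    · have e3 : (m s ≫ σ.pbp i h j) ≫ σ.pbF i p j = s.π.app j ≫ σ.pbF i p j := by
        rw [Category.assoc, pbp_fst, hm1]; exact (e1 s j).symm
      exact e3
    · have e3 : (m s ≫ σ.pbp i h j) ≫ σ.pbS i p j = s.π.app j ≫ σ.pbS i p j := by
        calc (m s ≫ σ.pbp i h j) ≫ σ.pbS i p j = m s ≫ σ.pbp i h j ≫ σ.pbS i p j :=
              Category.assoc _ _ _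
          _ = m s ≫ z ≫ σ.c.π.app j.left := congrArg (m s ≫ ·) (pbp_snd σ i h j)
          _ = (m s ≫ z) ≫ σ.c.π.app j.left := (Category.assoc _ _ _).symm
          _ = hw.lift (s' s) ≫ σ.c.π.app j.left := congrArg (· ≫ σ.c.π.app j.left) (hm2 s)
          _ = _ := hl s j
      exact e3
  · intro s m'' hm'
    let m' : s.pt ⟶ Z := m''
    have hm3 : ∀ j, m' ≫ σ.pbp i h j = s.π.app j := hm'
    refine h.hom_ext ?_ ?_
    · refine Eq.trans ?_ (hm1 s).symm
      have := congrArg (· ≫ σ.pbF i p _) (hm3 (Over.mk (𝟙 i)))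
      refine Eq.trans ?_ this
      exact (congrArg (m' ≫ ·) (pbp_fst σ i h _).symm).trans (Category.assoc _ _ _).symm
    · refine Eq.trans ?_ (hm2 s).symm
      refine hw.hom_ext fun j ↦ ?_
      refine Eq.trans ?_ (hl s j).symm
      refine Eq.trans ?_ (congrArg (· ≫ σ.pbS i p j) (hm3 j))
      exact (Category.assoc _ _ _).trans ((congrArg (m' ≫ ·) (pbp_snd σ i h j).symm).trans
        (Category.assoc _ _ _).symm)

/-- The base-changed system. -/
noncomputable def pb (σ : Sys.{u}) (i : σ.I) {P Z : Scheme.{u}} {p : P ⟶ σ.D.obj i} {g : Z ⟶ P}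
    [LocallyOfFiniteType p] [QuasiCompact p]
    {z : Z ⟶ σ.c.pt} (h : IsPullback g z p (σ.c.π.app i)) : Sys.{u} where
  I := Over i
  cat := inferInstance
  cof := inferInstance
  D := σ.pbD i p
  c := σ.pbC i h
  hc := (σ.pbC_isLimit i h).some
  aff f := σ.pbD_aff i p f
  ftz j := by
    exact ftz_of_isPullback (σ.pb_sq i p j) (σ.ftz j.left)

lemma exists_hom (σ : Sys.{u}) {S R : Scheme.{u}} (t : ∀ i, σ.D.obj i ⟶ S)
    (ht : ∀ {i j} (f : i ⟶ j), σ.D.map f ≫ t j = t i) (r : R ⟶ S) [LocallyOfFinitePresentation r]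
    (a : σ.c.pt ⟶ R) (ha : ∀ i, σ.c.π.app i ≫ t i = a ≫ r) :
    ∃ (i : σ.I) (h : σ.D.obj i ⟶ R), σ.c.π.app i ≫ h = a ∧ h ≫ r = t i := by
  have := fun i ↦ (σ.ftz i).compact
  have := fun i ↦ (σ.ftz i).noeth
  exact Scheme.exists_π_app_comp_eq_of_locallyOfFinitePresentation σ.D
    { app := t, naturality := fun i j f ↦ by
        rw [ht]; exact (Category.comp_id _).symm } r σ.c σ.hc a (by
      ext i : 2
      exact ha i)

lemma exists_hom_eq (σ : Sys.{u}) {S R : Scheme.{u}} (t : ∀ i, σ.D.obj i ⟶ S)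
    (ht : ∀ {i j} (f : i ⟶ j), σ.D.map f ≫ t j = t i) (r : R ⟶ S) [LocallyOfFiniteType r]
    {i : σ.I} (a b : σ.D.obj i ⟶ R) (ha : a ≫ r = t i) (hb : b ≫ r = t i)
    (h : σ.c.π.app i ≫ a = σ.c.π.app i ≫ b) :
    ∃ (j : σ.I) (f : j ⟶ i), σ.D.map f ≫ a = σ.D.map f ≫ b := by
  have := fun i ↦ (σ.ftz i).compact
  exact Scheme.exists_hom_comp_eq_comp_of_locallyOfFiniteType σ.D
    { app := t, naturality := fun i j f ↦ by
        rw [ht]; exact (Category.comp_id _).symm } r σ.c σ.hc a b ha.symm hb.symm h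

lemma exists_map (σ : Sys.{u}) {i : σ.I} {P Z R : Scheme.{u}} {p : P ⟶ σ.D.obj i} {g : Z ⟶ P}
    [LocallyOfFiniteType p] [QuasiCompact p]
    {z : Z ⟶ σ.c.pt} (h : IsPullback g z p (σ.c.π.app i)) (r : R ⟶ σ.D.obj i)
    [LocallyOfFiniteType r] (a : Z ⟶ R) (ha : a ≫ r = g ≫ p) :
    ∃ (j : σ.I) (f : j ⟶ i), ∀ {Q : Scheme.{u}} {u : Q ⟶ P} {q : Q ⟶ σ.D.obj j},
      IsPullback u q p (σ.D.map f) → ∃ m : Q ⟶ R, m ≫ r = u ≫ p ∧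
        ∀ w : Z ⟶ Q, w ≫ u = g → w ≫ q = z ≫ σ.c.π.app j → w ≫ m = a := by
  have := (σ.ftz i).lofp r
  have key : ∃ (j : Over i) (m : (σ.pbD i p).obj j ⟶ R), σ.pbp i h j ≫ m = a ∧
      m ≫ r = σ.pbF i p j ≫ p := (σ.pb i h).exists_hom
    (fun j : Over i ↦ σ.pbF i p j ≫ p)
    (fun f ↦ (Category.assoc _ _ _).symm.trans (congrArg (· ≫ p) (σ.pbD_fst i p f)))
    r a (fun j ↦ (Category.assoc _ _ _).symm.trans
      ((congrArg (· ≫ p) (σ.pbC_fst i h j)).trans ha.symm))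
  obtain ⟨j, m, h1, h2⟩ := key
  refine ⟨j.left, j.hom, fun {Q u q} hQ ↦ ?_⟩
  obtain ⟨n, hn1, hn2⟩ : ∃ n : Q ⟶ (σ.pbD i p).obj j, n ≫ σ.pbF i p j = u ∧
    n ≫ σ.pbS i p j = q := ⟨(σ.pb_sq i p j).lift u q hQ.w, (σ.pb_sq i p j).lift_fst _ _ _,
      (σ.pb_sq i p j).lift_snd _ _ _⟩
  refine ⟨n ≫ m, ?_, ?_⟩
  · rw [Category.assoc, h2, reassoc_of% hn1]
  · intro w hw1 hw2
    rw [← h1, ← Category.assoc]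
    congr 1
    refine (σ.pb_sq i p j).hom_ext ?_ ?_
    · rw [Category.assoc, hn1, hw1]
      exact (σ.pbp_fst i h j).symm
    · refine ((Category.assoc _ _ _).trans (congrArg (w ≫ ·) hn2)).trans ?_
      exact hw2.trans (σ.pbp_snd i h j).symm

lemma exists_map_eq (σ : Sys.{u}) {i : σ.I} {P Z R : Scheme.{u}} {p : P ⟶ σ.D.obj i} {g : Z ⟶ P}
    [LocallyOfFiniteType p] [QuasiCompact p]
    {z : Z ⟶ σ.c.pt} (h : IsPullback g z p (σ.c.π.app i)) (r : R ⟶ σ.D.obj i)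
    [LocallyOfFiniteType r] (a b : P ⟶ R) (ha : a ≫ r = p) (hb : b ≫ r = p)
    (hab : g ≫ a = g ≫ b) :
    ∃ (j : σ.I) (f : j ⟶ i), ∀ {Q : Scheme.{u}} {u : Q ⟶ P} {q : Q ⟶ σ.D.obj j},
      IsPullback u q p (σ.D.map f) → u ≫ a = u ≫ b := by
  have key : ∃ (j : Over i) (f : j ⟶ Over.mk (𝟙 i)),
      (σ.pbD i p).map f ≫ σ.pbF i p _ ≫ a = (σ.pbD i p).map f ≫ σ.pbF i p _ ≫ b :=
    (σ.pb i h).exists_hom_eq (i := Over.mk (𝟙 i))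
    (fun j : Over i ↦ σ.pbF i p j ≫ p)
    (fun f ↦ (Category.assoc _ _ _).symm.trans (congrArg (· ≫ p) (σ.pbD_fst i p f)))
    r (σ.pbF i p (Over.mk (𝟙 i)) ≫ a) (σ.pbF i p (Over.mk (𝟙 i)) ≫ b)
      ((Category.assoc _ _ _).trans (congrArg (σ.pbF i p (Over.mk (𝟙 i)) ≫ ·) ha))
      ((Category.assoc _ _ _).trans (congrArg (σ.pbF i p (Over.mk (𝟙 i)) ≫ ·) hb))
      (by
        refine (Category.assoc _ _ _).symm.trans (Eq.trans ?_ (Category.assoc _ _ _))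
        have := σ.pbC_fst i h (Over.mk (𝟙 i))
        exact (congrArg (· ≫ a) this).trans (hab.trans (congrArg (· ≫ b) this).symm))
  obtain ⟨j, f, h1⟩ := key
  refine ⟨j.left, j.hom, fun {Q u q} hQ ↦ ?_⟩
  have h2 := σ.pbD_fst i p f
  have h3 : σ.pbF i p j ≫ a = σ.pbF i p j ≫ b := by
    rw [← h2, Category.assoc, Category.assoc]
    exact h1
  rw [← (σ.pb_sq i p j).lift_fst u q hQ.w, Category.assoc, h3, Category.assoc]

end Sys

end CDF

namespace CDF

namespace Sys

lemma exists_map' (σ : Sys.{u}) {i : σ.I} {P Z R : Scheme.{u}} {p : P ⟶ σ.D.obj i} {g : Z ⟶ P}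
    [LocallyOfFiniteType p] [QuasiCompact p]
    {z : Z ⟶ σ.c.pt} (h : IsPullback g z p (σ.c.π.app i)) (r : R ⟶ σ.D.obj i)
    [LocallyOfFiniteType r] (a : Z ⟶ R) (ha : a ≫ r = g ≫ p) :
    ∃ (j : σ.I) (f : j ⟶ i), ∀ (k : σ.I) (t : k ⟶ j) {Q : Scheme.{u}} {u : Q ⟶ P}
      {q : Q ⟶ σ.D.obj k},
      IsPullback u q p (σ.D.map (t ≫ f)) → ∃ m : Q ⟶ R, m ≫ r = u ≫ p ∧
        ∀ w : Z ⟶ Q, w ≫ u = g → w ≫ q = z ≫ σ.c.π.app k → w ≫ m = a := by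
  obtain ⟨j, f, H⟩ := σ.exists_map h r a ha
  refine ⟨j, f, fun k t Q u q hQ ↦ ?_⟩
  obtain ⟨m, h1, h2⟩ := H (IsPullback.of_hasPullback p (σ.D.map f))
  obtain ⟨n, hn1, hn2⟩ : ∃ n : Q ⟶ pullback p (σ.D.map f), n ≫ pullback.fst _ _ = u ∧
    n ≫ pullback.snd _ _ = q ≫ σ.D.map t := by
    have w : u ≫ p = (q ≫ σ.D.map t) ≫ σ.D.map f := by
      rw [hQ.w, σ.D.map_comp, Category.assoc]
    exact ⟨pullback.lift _ _ w, pullback.lift_fst _ _ _, pullback.lift_snd _ _ _⟩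
  refine ⟨n ≫ m, ?_, fun w hw1 hw2 ↦ ?_⟩
  · rw [Category.assoc, h1, reassoc_of% hn1]
  · rw [← Category.assoc]
    refine h2 _ ?_ ?_
    · rw [Category.assoc, hn1, hw1]
    · rw [Category.assoc, hn2, reassoc_of% hw2, σ.c.w]

lemma exists_map_eq' (σ : Sys.{u}) {i : σ.I} {P Z R : Scheme.{u}} {p : P ⟶ σ.D.obj i} {g : Z ⟶ P}
    [LocallyOfFiniteType p] [QuasiCompact p]
    {z : Z ⟶ σ.c.pt} (h : IsPullback g z p (σ.c.π.app i)) (r : R ⟶ σ.D.obj i)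
    [LocallyOfFiniteType r] (a b : P ⟶ R) (ha : a ≫ r = p) (hb : b ≫ r = p)
    (hab : g ≫ a = g ≫ b) :
    ∃ (j : σ.I) (f : j ⟶ i), ∀ (k : σ.I) (t : k ⟶ j) {Q : Scheme.{u}} {u : Q ⟶ P}
      {q : Q ⟶ σ.D.obj k},
      IsPullback u q p (σ.D.map (t ≫ f)) → u ≫ a = u ≫ b := by
  obtain ⟨j, f, H⟩ := σ.exists_map_eq h r a b ha hb hab
  refine ⟨j, f, fun k t Q u q hQ ↦ ?_⟩
  have h1 := H (IsPullback.of_hasPullback p (σ.D.map f))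
  obtain ⟨n, hn1⟩ : ∃ n : Q ⟶ pullback p (σ.D.map f), n ≫ pullback.fst _ _ = u := by
    have w : u ≫ p = (q ≫ σ.D.map t) ≫ σ.D.map f := by
      rw [hQ.w, σ.D.map_comp, Category.assoc]
    exact ⟨pullback.lift _ _ w, pullback.lift_fst _ _ _⟩
  rw [← hn1, Category.assoc, h1, Category.assoc]

/-- pulling back a descent datum to a deeper level -/
lemma pull (σ : Sys.{u}) {i : σ.I} {P Z : Scheme.{u}} {p : P ⟶ σ.D.obj i} {g : Z ⟶ P}
    {z : Z ⟶ σ.c.pt} (h : IsPullback g z p (σ.c.π.app i)) {j : σ.I} (f : j ⟶ i)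
    {Q : Scheme.{u}} {u : Q ⟶ P} {q : Q ⟶ σ.D.obj j} (hQ : IsPullback u q p (σ.D.map f)) :
    ∃ w : Z ⟶ Q, w ≫ u = g ∧ IsPullback w z q (σ.c.π.app j) := by
  have e : g ≫ p = (z ≫ σ.c.π.app j) ≫ σ.D.map f := by
    rw [h.w, Category.assoc, σ.c.w]
  refine ⟨hQ.lift _ _ e, hQ.lift_fst _ _ _, ?_⟩
  refine IsPullback.of_right ?_ (hQ.lift_snd _ _ _) hQ
  rw [hQ.lift_fst, σ.c.w]
  exact h

lemma isoDesc (σ : Sys.{u}) {i : σ.I} {P P' L : Scheme.{u}} (a : P ⟶ σ.D.obj i)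
    (a' : P' ⟶ σ.D.obj i) [LocallyOfFiniteType a] [QuasiCompact a]
    [LocallyOfFiniteType a'] [QuasiCompact a'] {g : L ⟶ P} {g' : L ⟶ P'} {l : L ⟶ σ.c.pt}
    (h : IsPullback g l a (σ.c.π.app i)) (h' : IsPullback g' l a' (σ.c.π.app i)) :
    ∃ (j : σ.I) (f : j ⟶ i) (Q : Scheme.{u}) (q : Q ⟶ σ.D.obj j) (u : Q ⟶ P) (u' : Q ⟶ P'),
      IsPullback u q a (σ.D.map f) ∧ IsPullback u' q a' (σ.D.map f) ∧
      ∃ w : L ⟶ Q, w ≫ u = g ∧ w ≫ u' = g' ∧ IsPullback w l q (σ.c.π.app j) := by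
  obtain ⟨j1, f1, H1⟩ := σ.exists_map' h a' g' (by rw [h.w, h'.w])
  obtain ⟨j2, f2, H2⟩ := σ.exists_map' h' a g (by rw [h.w, h'.w])
  obtain ⟨j, t1, t2, e⟩ := IsCofiltered.cospan f1 f2
  obtain ⟨f, hf⟩ : ∃ f : j ⟶ i, f = t1 ≫ f1 := ⟨_, rfl⟩
  have S : IsPullback (pullback.fst a (σ.D.map f)) (pullback.snd a (σ.D.map f)) a (σ.D.map f) :=
    IsPullback.of_hasPullback _ _
  have S' : IsPullback (pullback.fst a' (σ.D.map f)) (pullback.snd a' (σ.D.map f)) a'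
    (σ.D.map f) := IsPullback.of_hasPullback _ _
  generalize pullback a (σ.D.map f) = Q, pullback.fst a (σ.D.map f) = u,
    pullback.snd a (σ.D.map f) = q at S
  generalize pullback a' (σ.D.map f) = Q', pullback.fst a' (σ.D.map f) = u',
    pullback.snd a' (σ.D.map f) = q' at S'
  obtain ⟨m, m1, m2⟩ := H1 j t1 (hf ▸ S)
  obtain ⟨m', m1', m2'⟩ := H2 j t2 (e ▸ hf ▸ S')
  obtain ⟨Φ, Φ1, Φ2⟩ : ∃ Φ : Q ⟶ Q', Φ ≫ u' = m ∧ Φ ≫ q' = q := by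
    have w : m ≫ a' = q ≫ σ.D.map f := by rw [m1, S.w]
    exact ⟨S'.lift _ _ w, S'.lift_fst _ _ w, S'.lift_snd _ _ w⟩
  obtain ⟨Ψ, Ψ1, Ψ2⟩ : ∃ Ψ : Q' ⟶ Q, Ψ ≫ u = m' ∧ Ψ ≫ q = q' := by
    have w : m' ≫ a = q' ≫ σ.D.map f := by rw [m1', S'.w]
    exact ⟨S.lift _ _ w, S.lift_fst _ _ w, S.lift_snd _ _ w⟩
  obtain ⟨w, w1, w2⟩ := σ.pull h f S
  obtain ⟨w', w1', w2'⟩ := σ.pull h' f S'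
  have wm : w ≫ m = g' := m2 w w1 w2.w
  have wm' : w' ≫ m' = g := m2' w' w1' w2'.w
  have wΦ : w ≫ Φ = w' := by
    refine S'.hom_ext ?_ ?_
    · rw [Category.assoc, Φ1, wm, w1']
    · rw [Category.assoc, Φ2, w2.w, w2'.w]
  have wΨ : w' ≫ Ψ = w := by
    refine S.hom_ext ?_ ?_
    · rw [Category.assoc, Ψ1, wm', w1]
    · rw [Category.assoc, Ψ2, w2.w, w2'.w]
  obtain ⟨_, _⟩ := loft_qc_of_isPullback S
  obtain ⟨_, _⟩ := loft_qc_of_isPullback S'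
  obtain ⟨k1, d1, E1⟩ := σ.exists_map_eq' w2 q (Φ ≫ Ψ) (𝟙 _)
    (by rw [Category.assoc, Ψ2, Φ2]) (Category.id_comp _)
    (by rw [reassoc_of% wΦ, wΨ, Category.comp_id])
  obtain ⟨k2, d2, E2⟩ := σ.exists_map_eq' w2' q' (Ψ ≫ Φ) (𝟙 _)
    (by rw [Category.assoc, Φ2, Ψ2]) (Category.id_comp _)
    (by rw [reassoc_of% wΨ, wΦ, Category.comp_id])
  obtain ⟨k, r1, r2, er⟩ := IsCofiltered.cospan d1 d2
  obtain ⟨d, hd⟩ : ∃ d : k ⟶ j, d = r1 ≫ d1 := ⟨_, rfl⟩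
  have T : IsPullback (pullback.fst q (σ.D.map d)) (pullback.snd q (σ.D.map d)) q (σ.D.map d) :=
    IsPullback.of_hasPullback _ _
  have T' : IsPullback (pullback.fst q' (σ.D.map d)) (pullback.snd q' (σ.D.map d)) q'
    (σ.D.map d) := IsPullback.of_hasPullback _ _
  generalize pullback q (σ.D.map d) = R, pullback.fst q (σ.D.map d) = v,
    pullback.snd q (σ.D.map d) = r at T
  generalize pullback q' (σ.D.map d) = R', pullback.fst q' (σ.D.map d) = v',
    pullback.snd q' (σ.D.map d) = r' at T'
  have F1 : v ≫ Φ ≫ Ψ = v := (E1 k r1 (hd ▸ T)).trans (Category.comp_id _)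
  have F2 : v' ≫ Ψ ≫ Φ = v' := (E2 k r2 (er ▸ hd ▸ T')).trans (Category.comp_id _)
  obtain ⟨A, A1, A2⟩ : ∃ A : R ⟶ R', A ≫ v' = v ≫ Φ ∧ A ≫ r' = r := by
    have w : (v ≫ Φ) ≫ q' = r ≫ σ.D.map d := by rw [Category.assoc, Φ2, T.w]
    exact ⟨T'.lift _ _ w, T'.lift_fst _ _ w, T'.lift_snd _ _ w⟩
  obtain ⟨A', A1', A2'⟩ : ∃ A' : R' ⟶ R, A' ≫ v = v' ≫ Ψ ∧ A' ≫ r = r' := by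
    have w : (v' ≫ Ψ) ≫ q = r' ≫ σ.D.map d := by rw [Category.assoc, Ψ2, T'.w]
    exact ⟨T.lift _ _ w, T.lift_fst _ _ w, T.lift_snd _ _ w⟩
  have AA : A ≫ A' = 𝟙 _ := by
    refine T.hom_ext ?_ ?_
    · rw [Category.assoc, A1', reassoc_of% A1, F1, Category.id_comp]
    · rw [Category.assoc, A2', A2, Category.id_comp]
  have AA' : A' ≫ A = 𝟙 _ := by
    refine T'.hom_ext ?_ ?_
    · rw [Category.assoc, A1, reassoc_of% A1', F2, Category.id_comp]
    · rw [Category.assoc, A2, A2', Category.id_comp]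
  have S2 : IsPullback (v ≫ u) r a (σ.D.map (d ≫ f)) := by
    rw [σ.D.map_comp]; exact T.paste_horiz S
  have S2' : IsPullback (v' ≫ u') r' a' (σ.D.map (d ≫ f)) := by
    rw [σ.D.map_comp]; exact T'.paste_horiz S'
  obtain ⟨x, x1, x2⟩ := σ.pull w2 d T
  refine ⟨k, d ≫ f, R, r, v ≫ u, A ≫ v' ≫ u', S2, ?_, x, ?_, ?_, x2⟩
  · exact S2'.of_iso ⟨A', A, AA', AA⟩ (Iso.refl _) (Iso.refl _) (Iso.refl _)
      (by simp [reassoc_of% AA']) (by simp [A2']) (by simp) (by simp)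
  · rw [reassoc_of% x1, w1]
  · rw [reassoc_of% A1, reassoc_of% x1, Φ1, wm]

end Sys

end CDF

namespace CDF

lemma exists_lower {I : Type*} [Category I] [IsCofiltered I] {ι : Type*} [Finite ι] (k : ι → I) :
    ∃ j, ∀ l, Nonempty (j ⟶ k l) := by
  classical
  cases nonempty_fintype ι
  obtain ⟨j, hj⟩ := IsCofiltered.inf_objs_exists (Finset.univ.image k)
  exact ⟨j, fun l ↦ hj (by simp)⟩

lemma ev_all {I : Type*} [Category I] [IsCofiltered I] {i : I} {ι : Type*} [Finite ι]
    (P : ι → ∀ j, (j ⟶ i) → Prop)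
    (hP : ∀ l j (f : j ⟶ i) k (t : k ⟶ j), P l j f → P l k (t ≫ f))
    (h : ∀ l, ∃ j f, P l j f) : ∃ j f, ∀ l, P l j f := by
  choose j f hf using h
  obtain ⟨k, hk⟩ := exists_lower (fun l ↦ Over.mk (f l))
  refine ⟨k.left, k.hom, fun l ↦ ?_⟩
  obtain ⟨t⟩ := hk l
  have := hP l _ _ _ t.left (hf l)
  have e : t.left ≫ f l = k.hom := Over.w t
  rw [e] at this
  exact this

namespace Sys

lemma qs (σ : Sys.{u}) (i : σ.I) : QuasiSeparatedSpace (σ.D.obj i) := by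
  have := (σ.ftz i).noeth
  infer_instance

lemma exists_functions (σ : Sys.{u}) {ι : Type*} [Finite ι] (g : ι → Γ(σ.c.pt, ⊤))
    (hg : ⨆ l, σ.c.pt.basicOpen (g l) = ⊤) (hga : ∀ l, IsAffineOpen (σ.c.pt.basicOpen (g l))) :
    ∃ (k : σ.I) (q : ι → Γ(σ.D.obj k, ⊤)), (∀ l, (σ.c.π.app k).appTop (q l) = g l) ∧
      ⨆ l, (σ.D.obj k).basicOpen (q l) = ⊤ ∧ ∀ l, IsAffineOpen ((σ.D.obj k).basicOpen (q l)) := by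
  have := fun i ↦ (σ.ftz i).compact
  have := σ.qs
  have hpre : ∀ {j k : σ.I} (f : j ⟶ k) (U : (σ.D.obj k).Opens),
      σ.c.π.app j ⁻¹ᵁ (σ.D.map f ⁻¹ᵁ U) = σ.c.π.app k ⁻¹ᵁ U := by
    intro j k f U
    rw [← Scheme.Hom.comp_preimage, σ.c.w]
  choose k1 q1 hq1 using fun l ↦ exists_appTop_π_eq_of_isLimit σ.D σ.c σ.hc (g l)
  choose k2 V hVa hV using fun l ↦ exists_isAffineOpen_preimage_eq σ.D σ.c σ.hc _ (hga l)
  obtain ⟨k, hk⟩ := exists_lower (Sum.elim k1 k2)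
  have t1 : ∀ l, k ⟶ k1 l := fun l ↦ (hk (Sum.inl l)).some
  have t2 : ∀ l, k ⟶ k2 l := fun l ↦ (hk (Sum.inr l)).some
  let q : ι → Γ(σ.D.obj k, ⊤) := fun l ↦ (σ.D.map (t1 l)).appTop (q1 l)
  have hq : ∀ l, (σ.c.π.app k).appTop (q l) = g l := by
    intro l
    rw [hq1 l, ← σ.c.w (t1 l), Scheme.Hom.comp_appTop]
    rfl
  have hqb : ∀ l, σ.c.π.app k ⁻¹ᵁ (σ.D.obj k).basicOpen (q l) = σ.c.pt.basicOpen (g l) := by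
    intro l
    rw [← hq l]
    exact Scheme.preimage_basicOpen_top _ _
  obtain ⟨a, fa, ha⟩ := exists_map_eq_top σ.D σ.c σ.hc (⨆ l, (σ.D.obj k).basicOpen (q l)) (by
    rw [Scheme.Hom.preimage_iSup, ← hg]
    exact iSup_congr hqb)
  obtain ⟨b, fb, hb⟩ := ev_all (i := a)
    (fun l j f ↦ σ.D.map (f ≫ fa) ⁻¹ᵁ (σ.D.obj k).basicOpen (q l) =
      σ.D.map (f ≫ fa ≫ t2 l) ⁻¹ᵁ V l) (by
      intro l j f j' t h
      rw [Category.assoc, σ.D.map_comp, Scheme.Hom.comp_preimage, h, Category.assoc,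
        ← Scheme.Hom.comp_preimage, ← σ.D.map_comp]) (by
      intro l
      obtain ⟨j, f, h⟩ := exists_map_preimage_eq_map_preimage σ.D σ.c σ.hc (i := a)
        (U := σ.D.map fa ⁻¹ᵁ (σ.D.obj k).basicOpen (q l)) (V := σ.D.map (fa ≫ t2 l) ⁻¹ᵁ V l)
        (by
          refine QuasiCompact.isCompact_preimage (f := σ.D.map fa) 
            ((σ.D.obj k).basicOpen (q l)) (TopologicalSpace.Opens.isOpen _) ?_
          exact isCompact_basicOpen _ isCompact_univ _)
        (by
          refine QuasiCompact.isCompact_preimage (f := σ.D.map (fa ≫ t2 l)) (V l)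
            (TopologicalSpace.Opens.isOpen _) ?_
          exact (hVa l).isCompact)
        (by rw [hpre, hpre, hqb, hV])
      refine ⟨j, f, ?_⟩
      rw [σ.D.map_comp, Scheme.Hom.comp_preimage, h, ← Scheme.Hom.comp_preimage, ← σ.D.map_comp])
  have hbo : ∀ l, (σ.D.obj b).basicOpen ((σ.D.map (fb ≫ fa)).appTop (q l)) =
      σ.D.map (fb ≫ fa) ⁻¹ᵁ (σ.D.obj k).basicOpen (q l) := fun l ↦
    (Scheme.preimage_basicOpen_top _ _).symm
  refine ⟨b, fun l ↦ (σ.D.map (fb ≫ fa)).appTop (q l), fun l ↦ ?_, ?_, fun l ↦ ?_⟩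
  · rw [← hq l, ← σ.c.w (fb ≫ fa), Scheme.Hom.comp_appTop]
    rfl
  · rw [iSup_congr hbo, ← Scheme.Hom.preimage_iSup, σ.D.map_comp, Scheme.Hom.comp_preimage, ha]
    rfl
  · rw [hbo, hb]
    exact (hVa l).preimage _

end Sys

end CDF

namespace CDF

lemma FTZ.specZ : FTZ (Spec (.of (ULift.{u} ℤ))) := by
  refine ⟨?_, inferInstance⟩
  rw [specULiftZIsTerminal.hom_ext (specULiftZIsTerminal.from _) (𝟙 _)]
  infer_instance

lemma FTZ.glue {T U V : Scheme.{u}} (i : U ⟶ T) (j : V ⟶ T) [IsOpenImmersion i]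
    [IsOpenImmersion j] (h : i.opensRange ⊔ j.opensRange = ⊤) (hU : FTZ U) (hV : FTZ V) :
    FTZ T := by
  have : Finite (cover2 i j h).I₀ := inferInstanceAs (Finite Bool)
  refine FTZ.of_cover (cover2 i j h) ?_
  rintro (_ | _)
  · exact hV
  · exact hU

lemma noeth_opens {B : Scheme.{u}} [IsNoetherian B] (U : B.Opens) : IsNoetherian U := by
  have : IsLocallyNoetherian U := LocallyOfFiniteType.isLocallyNoetherian U.ι
  have : CompactSpace U := QuasiCompact.compactSpace_of_compactSpace U.ι
  exact {}

lemma isPullback_lift_opens {W U D : Scheme.{u}} (w : W ⟶ U) [IsOpenImmersion w] (π : U ⟶ D)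
    (O : D.Opens) (h : π ⁻¹ᵁ O = w.opensRange) : ∃ ω : W ⟶ O, IsPullback ω w O.ι π := by
  have hr : (w ≫ π) ⁻¹ᵁ O = ⊤ := by
    rw [Scheme.Hom.comp_preimage, h, Scheme.Hom.preimage_opensRange]
  have hr' : Set.range (w ≫ π) ⊆ Set.range O.ι := by
    rintro _ ⟨x, rfl⟩
    have : x ∈ (w ≫ π) ⁻¹ᵁ O := hr ▸ trivial
    simpa using this
  refine ⟨IsOpenImmersion.lift O.ι (w ≫ π) hr', ?_⟩
  refine IsOpenImmersion.isPullback _ _ _ _ (IsOpenImmersion.lift_fac _ _ _).symm ?_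
  rw [Scheme.Opens.opensRange_ι, h]

namespace Sys

lemma exists_functions_pb (σ : Sys.{u}) {i : σ.I} {P Z : Scheme.{u}} {p : P ⟶ σ.D.obj i}
    {g : Z ⟶ P} [LocallyOfFiniteType p] [QuasiCompact p]
    {z : Z ⟶ σ.c.pt} (h : IsPullback g z p (σ.c.π.app i)) {ι : Type*} [Finite ι] (s : ι → Γ(Z, ⊤))
    (hs : ⨆ l, Z.basicOpen (s l) = ⊤) (hsa : ∀ l, IsAffineOpen (Z.basicOpen (s l))) :
    ∃ (k : σ.I) (f : k ⟶ i) (Q : Scheme.{u}) (u : Q ⟶ P) (q : Q ⟶ σ.D.obj k)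
      (_ : IsPullback u q p (σ.D.map f)) (w : Z ⟶ Q) (_ : w ≫ u = g)
      (_ : IsPullback w z q (σ.c.π.app k)) (r : ι → Γ(Q, ⊤)), (∀ l, w.appTop (r l) = s l) ∧
      ⨆ l, Q.basicOpen (r l) = ⊤ ∧ ∀ l, IsAffineOpen (Q.basicOpen (r l)) := by
  have key : ∃ (k : Over i) (q : ι → Γ((σ.pbD i p).obj k, ⊤)),
      (∀ l, (σ.pbp i h k).appTop (q l) = s l) ∧
      ⨆ l, ((σ.pbD i p).obj k).basicOpen (q l) = ⊤ ∧
      ∀ l, IsAffineOpen (((σ.pbD i p).obj k).basicOpen (q l)) :=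
    (σ.pb i h).exists_functions (ι := ι) s hs hsa
  obtain ⟨k, q, h1, h2, h3⟩ := key
  refine ⟨k.left, k.hom, _, _, _, σ.pb_sq i p k, σ.pbp i h k, σ.pbp_fst i h k, ?_, q, h1, h2, h3⟩
  refine IsPullback.of_right ?_ (σ.pbp_snd i h k) (σ.pb_sq i p k)
  rw [pbp_fst]
  have e : σ.c.π.app k.left ≫ σ.D.map k.hom = σ.c.π.app i := σ.c.w k.hom
  have h' := h
  rw [← e] at h'
  exact h'

end Sys

lemma weak_step (σ : Sys.{u}) {B : Scheme.{u}} [IsNoetherian B] {A : CommRingCat.{u}}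
    (i : σ.c.pt ⟶ B) (j : Spec A ⟶ B) [IsOpenImmersion i] [IsOpenImmersion j]
    (hc : i.opensRange ⊔ j.opensRange = ⊤) :
    ∃ (B₀ : Scheme.{u}) (_ : FTZ B₀) (π : B ⟶ B₀), IsAffineHom π := by
  have hB : IsPullback (pullback.fst i j) (pullback.snd i j) i j := IsPullback.of_hasPullback i j
  have o1 : IsOpenImmersion (pullback.fst i j) := inferInstance
  have o2 : IsOpenImmersion (pullback.snd i j) := inferInstance
  have : IsLocallyNoetherian σ.c.pt := LocallyOfFiniteType.isLocallyNoetherian i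
  have : CompactSpace σ.c.pt := QuasiCompact.compactSpace_of_compactSpace i
  have : IsNoetherian σ.c.pt := {}
  generalize pullback i j = W, pullback.fst i j = wU, pullback.snd i j = i' at hB o1 o2
  have : CompactSpace W := QuasiCompact.compactSpace_of_compactSpace wU
  obtain ⟨a, O, hO, hO'⟩ := exists_preimage_eq σ.D σ.c σ.hc wU.opensRange
    (isCompact_range wU.continuous)
  have := (σ.ftz a).noeth
  obtain ⟨ω₁, hω₁⟩ := isPullback_lift_opens wU (σ.c.π.app a) O hO'
  obtain ⟨s, hs, hsU⟩ := exists_basicOpens i'.opensRange (isCompact_range i'.continuous)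
  let g : s → Γ(Spec A, ⊤) := fun l ↦ (Scheme.ΓSpecIso A).inv (l : A)
  have hg : ∀ l, (Spec A).basicOpen (g l) = PrimeSpectrum.basicOpen (l : A) := fun l ↦
    basicOpen_eq_of_affine _
  have hgi : ∀ l, W.basicOpen (i'.appTop (g l)) = i' ⁻¹ᵁ PrimeSpectrum.basicOpen (l : A) := by
    intro l
    rw [← hg]
    exact (Scheme.preimage_basicOpen_top _ _).symm
  obtain ⟨k, f, W₀, u, a0, hQ, ω, hωu, hω, q, hq1, hq2, hq3⟩ := σ.exists_functions_pb hω₁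
    (fun l : s ↦ i'.appTop (g l)) (by
      rw [iSup_congr hgi]
      refine (Scheme.Hom.preimage_iSup i' (fun l : s ↦ PrimeSpectrum.basicOpen (l : A))).symm.trans ?_
      refine (congrArg (fun U ↦ i' ⁻¹ᵁ U) hsU.symm).trans ?_
      exact Scheme.Hom.preimage_opensRange _) (by
      intro l
      rw [hgi]
      refine IsAffineOpen.preimage_of_isOpenImmersion ?_ i' ?_
      · rw [← hg]
        exact (isAffineOpen_top _).basicOpen _
      · rw [hsU]
        exact le_iSup (fun l : s ↦ (PrimeSpectrum.basicOpen (l : A))) l)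
  have oa0 : IsOpenImmersion a0 := MorphismProperty.of_isPullback hQ inferInstance
  have hk := (σ.ftz k).noeth
  have hW₀ : FTZ W₀ := (σ.ftz k).of_hom a0
  have := hW₀.noeth
  let A₀ := CommRingCat.of (ULift.{u} ℤ)
  let α : A₀ ⟶ Γ(Spec A, ⊤) := CommRingCat.isInitial.to _
  let β : A₀ ⟶ Γ(W₀, ⊤) := CommRingCat.isInitial.to _
  have hβ : LocallyOfFiniteType (toS β) := hW₀.hom _
  obtain ⟨R, γ, v, θ, r, h1, -, -, -, -, -, h7, -, h9⟩ := core i' ω α β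
    (CommRingCat.isInitial.hom_ext _ _) g q hq1 (by rw [hsU]; exact (iSup_congr hg).symm)
    hq2 hq3
  obtain ⟨T, k', e, ok, oe, hT, hk⟩ := exists_glue a0 (toS θ)
  obtain ⟨m, hm1, hm2⟩ := glue_map i j hc hB k' e hk (σ.c.π.app k) (toS v) ω hω h9
  have hLR : LocallyOfFiniteType (Spec.map γ) := by
    rw [HasRingHomProperty.Spec_iff (P := @LocallyOfFiniteType)]
    exact h1
  refine ⟨T, FTZ.glue k' e hT (σ.ftz k) (FTZ.specZ.of_hom (Spec.map γ)), m, ?_⟩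
  have := zlAff.{u}
  have := isAffineHom_π_app σ.D σ.c σ.hc k
  exact local2 @IsAffineHom.{u} k' e hT m hm1 hm2 inferInstance inferInstance

lemma weak (B : Scheme.{u}) [IsNoetherian B] :
    ∃ (B₀ : Scheme.{u}) (_ : FTZ B₀) (π : B ⟶ B₀), IsAffineHom π := by
  have key : ∀ S : B.Opens, ∃ (B₀ : Scheme.{u}) (_ : FTZ B₀) (π : S.toScheme ⟶ B₀),
      IsAffineHom π := by
    intro S
    refine compact_open_induction_on S (TopologicalSpace.NoetherianSpace.isCompact _) ?_ ?_
    · refine ⟨_, FTZ.specZ, specULiftZIsTerminal.from _, ?_⟩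
      have : IsAffine (⊥ : B.Opens) := isAffineOpen_bot B
      infer_instance
    · rintro U hU V ⟨B₀, hB₀, π, hπ⟩
      obtain ⟨A, j, oj, hj, -⟩ := exists_cover_sup U V
      obtain ⟨σ, hσ⟩ := exists_sys hB₀ π
      have : IsNoetherian (U ⊔ V.1 : B.Opens) := noeth_opens _
      obtain ⟨i, oi, hi⟩ : ∃ (i : σ.c.pt ⟶ (U ⊔ V.1 : B.Opens)) (_ : IsOpenImmersion i),
          i.opensRange ⊔ j.opensRange = ⊤ := by
        rw [hσ]
        exact ⟨_, inferInstance, hj⟩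
      exact weak_step σ i j hi
  obtain ⟨B₀, h, π, hπ⟩ := key ⊤
  refine ⟨B₀, h, B.topIso.inv ≫ π, inferInstance⟩

lemma exists_sys' (B : Scheme.{u}) [IsNoetherian B] : ∃ σ : Sys.{u}, σ.c.pt = B := by
  obtain ⟨B₀, h, π, hπ⟩ := weak B
  exact exists_sys h π

end CDF

namespace CDF

open TensorProduct in
lemma ring_model {R A : CommRingCat.{u}} (φ : R ⟶ A) (hφ : φ.hom.FinitePresentation) :
    ∃ C : Set R, C.Finite ∧ ∀ (R₀ : CommRingCat.{u}) (ψ : R₀ ⟶ R), (∀ c ∈ C, ∃ t, c = ψ t) →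
      ∃ (M : CommRingCat.{u}) (γ : R₀ ⟶ M) (θ : M ⟶ A), γ.hom.FiniteType ∧ IsPushout ψ γ φ θ := by
  letI : Algebra R A := φ.hom.toAlgebra
  have : Algebra.FinitePresentation R A := hφ
  obtain ⟨n, m, ⟨P⟩⟩ := Algebra.Presentation.exists_presentation_fin R A
  refine ⟨P.coeffs, P.finite_coeffs, fun R₀ ψ h ↦ ?_⟩
  letI : Algebra R₀ R := ψ.hom.toAlgebra
  letI : Algebra R₀ A := (φ.hom.comp ψ.hom).toAlgebra
  haveI : IsScalarTower R₀ R A := IsScalarTower.of_algebraMap_eq fun _ ↦ rfl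
  haveI : P.HasCoeffs R₀ := ⟨fun c hc ↦ by
    obtain ⟨t, ht⟩ := h c hc
    exact ⟨t, ht.symm⟩⟩
  let e := P.tensorModelOfHasCoeffsEquiv R₀
  refine ⟨CommRingCat.of (P.ModelOfHasCoeffs R₀), CommRingCat.ofHom (algebraMap _ _),
    CommRingCat.ofHom (e.toRingHom.comp
      (Algebra.TensorProduct.includeRight (R := R₀) (A := R) (B := P.ModelOfHasCoeffs R₀)).toRingHom), ?_, ?_⟩
  · have : Algebra.FiniteType R₀ (P.ModelOfHasCoeffs R₀) := inferInstance
    change (algebraMap R₀ (P.ModelOfHasCoeffs R₀)).FiniteType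
    rwa [RingHom.finiteType_algebraMap]
  · refine (CommRingCat.isPushout_tensorProduct R₀ R (P.ModelOfHasCoeffs R₀)).of_iso
      (Iso.refl _) (Iso.refl _) (Iso.refl _) e.toRingEquiv.toCommRingCatIso ?_ ?_ ?_ ?_
    · ext; rfl
    · ext; rfl
    · ext r
      exact e.commutes r
    · rfl

/-- affine descent -/
lemma desc_aff (σ : Sys.{u}) (hσ : ∀ i, IsAffine (σ.D.obj i)) [IsNoetherian σ.c.pt]
    {X : Scheme.{u}} [IsAffine X] (x : X ⟶ σ.c.pt) [LocallyOfFiniteType x] :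
    ∃ (i : σ.I) (P : Scheme.{u}) (p : P ⟶ σ.D.obj i) (_ : LocallyOfFiniteType p)
      (_ : QuasiCompact p) (g : X ⟶ P), IsPullback g x p (σ.c.π.app i) := by
  have hne := σ.cof.nonempty
  have hca : IsAffine σ.c.pt := by
    have i := hne.some
    have := isAffineHom_π_app σ.D σ.c σ.hc i
    exact isAffine_of_isAffineHom (σ.c.π.app i)
  have hfp : LocallyOfFinitePresentation x := by
    rwa [LocallyOfFinitePresentation.iff_locallyOfFiniteType]
  have hφ : x.appTop.hom.FinitePresentation := by
    rwa [HasRingHomProperty.iff_of_isAffine (P := @LocallyOfFinitePresentation)] at hfp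
  obtain ⟨C, hC, H⟩ := ring_model x.appTop hφ
  have := hC.to_subtype
  have hcoef : ∀ c : C, ∃ i t, (c : Γ(σ.c.pt, ⊤)) = (σ.c.π.app i).appTop t := fun c ↦
    have := fun i ↦ (σ.ftz i).compact
    have := fun i ↦ (σ.ftz i).noeth
    exists_appTop_π_eq_of_isLimit σ.D σ.c σ.hc c
  choose k t hk using hcoef
  obtain ⟨j, hj⟩ := exists_lower k
  have hlow : ∀ c ∈ C, ∃ t, c = (σ.c.π.app j).appTop t := by
    intro c hc
    obtain ⟨f⟩ := hj ⟨c, hc⟩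
    refine ⟨(σ.D.map f).appTop (t ⟨c, hc⟩), ?_⟩
    refine (hk ⟨c, hc⟩).trans ?_
    rw [← CommRingCat.comp_apply, ← Scheme.Hom.comp_appTop, σ.c.w]
  obtain ⟨M, γ, θ, hγ, hp⟩ := H _ (σ.c.π.app j).appTop hlow
  have hs := isPullback_SpecMap_of_isPushout _ _ _ _ hp.flip
  have : IsAffine (σ.D.obj j) := hσ j
  have hL : LocallyOfFiniteType (Spec.map γ) := by
    rw [HasRingHomProperty.Spec_iff (P := @LocallyOfFiniteType)]
    exact hγ
  refine ⟨j, Spec M, Spec.map γ ≫ (σ.D.obj j).isoSpec.inv, inferInstance, inferInstance,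
    X.isoSpec.hom ≫ Spec.map θ, ?_⟩
  refine hs.of_iso X.isoSpec.symm (Iso.refl _) σ.c.pt.isoSpec.symm (σ.D.obj j).isoSpec.symm
    ?_ ?_ ?_ ?_
  · simp
  · simp [Scheme.isoSpec_inv_naturality]
  · simp
  · simp [Scheme.isoSpec_inv_naturality]

/-- `x` descends to a finite level of the system -/
def Desc (σ : Sys.{u}) {X : Scheme.{u}} (x : X ⟶ σ.c.pt) : Prop :=
  ∃ (i : σ.I) (P : Scheme.{u}) (p : P ⟶ σ.D.obj i) (_ : LocallyOfFiniteType p)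
      (_ : QuasiCompact p) (g : X ⟶ P), IsPullback g x p (σ.c.π.app i)

lemma desc_pb (σ : Sys.{u}) {i : σ.I} {P Z X : Scheme.{u}} {p : P ⟶ σ.D.obj i}
    {g : Z ⟶ P} [LocallyOfFiniteType p] [QuasiCompact p]
    {z : Z ⟶ σ.c.pt} (h : IsPullback g z p (σ.c.π.app i)) (x : X ⟶ Z)
    (H : Desc (σ.pb i h) x) : Desc σ (x ≫ z) := by
  have key : ∃ (k : Over i) (Q : Scheme.{u}) (q : Q ⟶ (σ.pbD i p).obj k)
      (_ : LocallyOfFiniteType q) (_ : QuasiCompact q) (g : X ⟶ Q),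
      IsPullback g x q (σ.pbp i h k) := H
  obtain ⟨k, Q, q, _, _, g', hg'⟩ := key
  obtain ⟨_, _⟩ := loft_qc_of_isPullback (σ.pb_sq i p k)
  refine ⟨k.left, Q, q ≫ σ.pbS i p k, inferInstance, inferInstance, g', ?_⟩
  refine hg'.paste_vert ?_
  refine IsPullback.of_right ?_ (σ.pbp_snd i h k) (σ.pb_sq i p k)
  rw [Sys.pbp_fst]
  have e : σ.c.π.app k.left ≫ σ.D.map k.hom = σ.c.π.app i := σ.c.w k.hom
  have h' := h
  rw [← e] at h'
  exact h'


lemma lift_open {X Z D : Scheme.{u}} (π : Z ⟶ D) (U : D.Opens) (x : X ⟶ Z)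
    (hx : ∀ a, x a ∈ π ⁻¹ᵁ U) : ∃ (W : Scheme.{u}) (g : W ⟶ U) (z : W ⟶ Z) (x' : X ⟶ W),
      IsOpenImmersion z ∧ IsPullback g z U.ι π ∧ x' ≫ z = x :=
  ⟨_, _, _, IsOpenImmersion.lift (π ⁻¹ᵁ U).ι x (by rintro _ ⟨a, rfl⟩; simpa using hx a),
    inferInstance, isPullback_morphismRestrict π U, IsOpenImmersion.lift_fac _ _ _⟩

lemma desc_local (σ : Sys.{u}) [IsNoetherian σ.c.pt] {X : Scheme.{u}} [IsAffine X]
    (x : X ⟶ σ.c.pt) [LocallyOfFiniteType x] (i : σ.I) (U : (σ.D.obj i).Opens)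
    (hU : IsAffineOpen U) (hx : ∀ a, x a ∈ σ.c.π.app i ⁻¹ᵁ U) : Desc σ x := by
  have := (σ.ftz i).noeth
  obtain ⟨Z, g, z, x', _, h, rfl⟩ := lift_open (σ.c.π.app i) U x hx
  have : LocallyOfFiniteType x' := locallyOfFiniteType_of_comp x' z
  have : IsAffine U := hU
  have : IsLocallyNoetherian Z := LocallyOfFiniteType.isLocallyNoetherian (Y := σ.c.pt) z
  have : CompactSpace Z := QuasiCompact.compactSpace_of_compactSpace (Y := σ.c.pt) z
  have hn : IsNoetherian Z := {}
  refine desc_pb σ h x' ?_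
  have : IsNoetherian (σ.pb i h).c.pt := hn
  have : LocallyOfFiniteType (Y := (σ.pb i h).c.pt) x' := ‹LocallyOfFiniteType x'›
  refine desc_aff (σ.pb i h) (fun k ↦ ?_) x'
  change IsAffine ((σ.pbD i U.ι).obj k)
  have ha : IsAffineHom (σ.pbF i U.ι k) := by
    have := isAffineHom_isStableUnderBaseChange.{u}
    exact this.of_isPullback (σ.pb_sq i U.ι k).flip (σ.aff k.hom)
  exact isAffine_of_isAffineHom (σ.pbF i U.ι k)

end CDF

namespace CDF

lemma desc_open (σ : Sys.{u}) {i : σ.I} {P Z W : Scheme.{u}} {p : P ⟶ σ.D.obj i}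
    {g : Z ⟶ P} [LocallyOfFiniteType p] [QuasiCompact p]
    {z : Z ⟶ σ.c.pt} (h : IsPullback g z p (σ.c.π.app i)) (w : W ⟶ Z) [IsOpenImmersion w]
    [CompactSpace W] :
    ∃ (k : σ.I) (f : k ⟶ i) (Q O : Scheme.{u}) (u : Q ⟶ P) (q : Q ⟶ σ.D.obj k)
      (_ : IsPullback u q p (σ.D.map f)) (w' : Z ⟶ Q) (_ : w' ≫ u = g)
      (_ : IsPullback w' z q (σ.c.π.app k)) (o : O ⟶ Q) (_ : IsOpenImmersion o) (ω : W ⟶ O),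
      IsPullback ω w o w' := by
  have key : ∃ (k : Over i) (O : ((σ.pbD i p).obj k).Opens), IsCompact (O : Set ((σ.pbD i p).obj k)) ∧
      (σ.pbp i h k) ⁻¹ᵁ O = w.opensRange :=
    have := fun k ↦ ((σ.pb i h).ftz k).compact
    have := fun k ↦ ((σ.pb i h).ftz k).noeth
    exists_preimage_eq (σ.pb i h).D (σ.pb i h).c (σ.pb i h).hc w.opensRange
      (isCompact_range w.continuous)
  obtain ⟨k, O, -, hO⟩ := key
  obtain ⟨ω, hω⟩ := isPullback_lift_opens w _ O hO
  refine ⟨k.left, k.hom, _, O, _, _, σ.pb_sq i p k, σ.pbp i h k, σ.pbp_fst i h k, ?_,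
    O.ι, inferInstance, ω, hω⟩
  refine IsPullback.of_right ?_ (σ.pbp_snd i h k) (σ.pb_sq i p k)
  rw [Sys.pbp_fst]
  have e : σ.c.π.app k.left ≫ σ.D.map k.hom = σ.c.π.app i := σ.c.w k.hom
  have h' := h
  rw [← e] at h'
  exact h'

/-- a descended object together with a descended open subobject, at level `i` -/
def DescO (σ : Sys.{u}) {X W : Scheme.{u}} (x : X ⟶ σ.c.pt) (w : W ⟶ X) (i : σ.I) : Prop :=
  ∃ (P O : Scheme.{u}) (p : P ⟶ σ.D.obj i) (_ : LocallyOfFiniteType p)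
      (_ : QuasiCompact p) (g : X ⟶ P) (_ : IsPullback g x p (σ.c.π.app i))
      (o : O ⟶ P) (_ : IsOpenImmersion o) (ω : W ⟶ O), IsPullback ω w o g

lemma descO_of_desc (σ : Sys.{u}) {X W : Scheme.{u}} (x : X ⟶ σ.c.pt) (w : W ⟶ X)
    [IsOpenImmersion w] [CompactSpace W] (H : Desc σ x) : ∃ i, DescO σ x w i := by
  obtain ⟨i, P, p, _, _, g, h⟩ := H
  obtain ⟨k, f, Q, O, u, q, hQ, w', h1, h2, o, _, ω, h3⟩ := desc_open σ h w
  obtain ⟨_, _⟩ := loft_qc_of_isPullback hQ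
  exact ⟨k, Q, O, q, ‹_›, ‹_›, w', h2, o, ‹_›, ω, h3⟩

lemma descO_pull (σ : Sys.{u}) {X W : Scheme.{u}} (x : X ⟶ σ.c.pt) (w : W ⟶ X)
    {i j : σ.I} (f : j ⟶ i) (H : DescO σ x w i) : DescO σ x w j := by
  obtain ⟨P, O, p, _, _, g, h, o, _, ω, h'⟩ := H
  have hQ : IsPullback (pullback.fst p (σ.D.map f)) (pullback.snd p (σ.D.map f)) p (σ.D.map f) :=
    IsPullback.of_hasPullback _ _
  generalize pullback p (σ.D.map f) = Q, pullback.fst p (σ.D.map f) = u,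
    pullback.snd p (σ.D.map f) = q at hQ
  obtain ⟨_, _⟩ := loft_qc_of_isPullback hQ
  obtain ⟨v, hv, hv'⟩ := σ.pull h f hQ
  have hR : IsPullback (pullback.fst o u) (pullback.snd o u) o u :=
    IsPullback.of_hasPullback _ _
  have : IsOpenImmersion (pullback.snd o u) := inferInstance
  refine ⟨Q, _, q, ‹_›, ‹_›, v, hv', _, this, hR.lift ω (w ≫ v) ?_, ?_⟩
  · rw [Category.assoc, hv, h'.w]
  · refine IsPullback.of_right ?_ (hR.lift_snd _ _ _) hR
    rw [hR.lift_fst, hv]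
    exact h'

lemma desc_glue (σ : Sys.{u}) {X U V W : Scheme.{u}} (x : X ⟶ σ.c.pt) (iU : U ⟶ X) (iV : V ⟶ X)
    [IsOpenImmersion iU] [IsOpenImmersion iV] (hc : iU.opensRange ⊔ iV.opensRange = ⊤)
    {a : W ⟶ U} {b : W ⟶ V} [IsOpenImmersion a] [IsOpenImmersion b] [CompactSpace W]
    (hW : IsPullback a b iU iV) (hU : Desc σ (iU ≫ x)) (hV : Desc σ (iV ≫ x)) : Desc σ x := by
  obtain ⟨k1, H1⟩ := descO_of_desc σ _ a hU
  obtain ⟨k2, H2⟩ := descO_of_desc σ _ b hV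
  obtain ⟨P, O, p, _, _, g, h, o, _, ω, s⟩ := descO_pull σ _ a (IsCofiltered.minToLeft k1 k2) H1
  obtain ⟨P', O', p', _, _, g', h', o', _, ω', s'⟩ :=
    descO_pull σ _ b (IsCofiltered.minToRight k1 k2) H2
  generalize IsCofiltered.min k1 k2 = k at *
  have t : IsPullback ω (a ≫ iU ≫ x) (o ≫ p) (σ.c.π.app k) := s.paste_vert h
  have t' : IsPullback ω' (a ≫ iU ≫ x) (o' ≫ p') (σ.c.π.app k) := by
    rw [reassoc_of% hW.w]
    exact s'.paste_vert h'
  have := (σ.ftz k).noeth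
  have := ((σ.ftz k).of_hom p).noeth
  have := ((σ.ftz k).of_hom p').noeth
  obtain ⟨j, f, Q, q, u, u', hQ, hQ', w, w1, w2, hw⟩ := σ.isoDesc (o ≫ p) (o' ≫ p') t t'
  have S : IsPullback (pullback.fst p (σ.D.map f)) (pullback.snd p (σ.D.map f)) p (σ.D.map f) :=
    IsPullback.of_hasPullback _ _
  have S' : IsPullback (pullback.fst p' (σ.D.map f)) (pullback.snd p' (σ.D.map f)) p' (σ.D.map f) :=
    IsPullback.of_hasPullback _ _
  generalize pullback p (σ.D.map f) = R, pullback.fst p (σ.D.map f) = v,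
    pullback.snd p (σ.D.map f) = r at S
  generalize pullback p' (σ.D.map f) = R', pullback.fst p' (σ.D.map f) = v',
    pullback.snd p' (σ.D.map f) = r' at S'
  have step : ∀ {X P O R Q W : Scheme.{u}} {x : X ⟶ σ.c.pt} {p : P ⟶ σ.D.obj k} {g : X ⟶ P}
      {o : O ⟶ P} {ω : W ⟶ O} {v : R ⟶ P} {r : R ⟶ σ.D.obj j} {u : Q ⟶ O} {q : Q ⟶ σ.D.obj j}
      {w : W ⟶ Q} {a : W ⟶ X}, IsOpenImmersion o → IsPullback g x p (σ.c.π.app k) →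
      IsPullback ω a o g → IsPullback v r p (σ.D.map f) → IsPullback u q (o ≫ p) (σ.D.map f) →
      w ≫ u = ω → w ≫ q = a ≫ x ≫ σ.c.π.app j →
      ∃ (α : Q ⟶ R) (G : X ⟶ R), IsOpenImmersion α ∧ α ≫ r = q ∧ IsPullback G x r (σ.c.π.app j) ∧
        IsPullback w a α G := by
    intro X P O R Q W x p g o ω v r u q w a ho h s S hQ w1 w2
    obtain ⟨G, hG, hG'⟩ := σ.pull h f S
    have e : (u ≫ o) ≫ p = q ≫ σ.D.map f := by rw [Category.assoc, hQ.w]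
    have hα : IsPullback u (S.lift _ _ e) o v := by
      refine IsPullback.of_bot ?_ (S.lift_fst _ _ e).symm S
      rw [S.lift_snd]
      exact hQ
    refine ⟨S.lift _ _ e, G, MorphismProperty.of_isPullback hα ho, S.lift_snd _ _ e, hG', ?_⟩
    refine IsPullback.of_right ?_ ?_ hα
    · rw [w1, hG]; exact s
    · refine S.hom_ext ?_ ?_
      · rw [Category.assoc, S.lift_fst, Category.assoc, hG, reassoc_of% w1, s.w]
      · rw [Category.assoc, S.lift_snd, w2, Category.assoc, hG'.w]
  obtain ⟨α, G, oα, hα, hG, hαG⟩ := step inferInstance h s S hQ w1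
    (by rw [hw.w]; simp only [Category.assoc])
  obtain ⟨β, G', oβ, hβ, hG', hβG⟩ := step inferInstance h' s' S' hQ' w2
    (by rw [hw.w, reassoc_of% hW.w]; simp only [Category.assoc])
  obtain ⟨T, i1, i2, _, _, hT, hT'⟩ := exists_glue α β
  obtain ⟨m, hm1, hm2⟩ := glue_map iU iV hc hW i1 i2 hT' G G' w hαG hβG
  obtain ⟨ρ, hρ1, hρ2⟩ := glue2 i1 i2 hT hT' r r' (by rw [hα, hβ])
  have fT : FTZ T := FTZ.glue i1 i2 hT (ftz_of_isPullback S (σ.ftz j))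
    (ftz_of_isPullback S' (σ.ftz j))
  refine ⟨j, T, ρ, fT.hom _, fT.qc _, m, ?_⟩
  refine isPullback_glue i1 i2 hT ?_ hm1 hm2 (by rw [hρ1]; exact hG) (by rw [hρ2]; exact hG')
  refine hom_ext2 iU iV hc _ _ ?_ ?_
  · rw [← reassoc_of% hm1.w, hρ1, hG.w, Category.assoc]
  · rw [← reassoc_of% hm2.w, hρ2, hG'.w, Category.assoc]

lemma desc_all (σ : Sys.{u}) [IsNoetherian σ.c.pt] {X : Scheme.{u}} (x : X ⟶ σ.c.pt)
    [LocallyOfFiniteType x] [QuasiCompact x] : Desc σ x := by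
  have : IsLocallyNoetherian X := LocallyOfFiniteType.isLocallyNoetherian (Y := σ.c.pt) x
  have : CompactSpace X := QuasiCompact.compactSpace_of_compactSpace (Y := σ.c.pt) x
  have : IsNoetherian X := {}
  obtain ⟨i⟩ := σ.cof.nonempty
  have hb : Desc σ ((⊥ : X.Opens).ι ≫ x) := by
    have : IsAffine (⊥ : X.Opens) := isAffineOpen_bot X
    exact desc_local σ _ i ⊥ (isAffineOpen_bot _) (fun a ↦ a.2.elim)
  have hsup : ∀ U V : X.Opens, Desc σ (U.ι ≫ x) → Desc σ (V.ι ≫ x) →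
      Desc σ ((U ⊔ V).ι ≫ x) := by
    intro U V hU hV
    let a := X.homOfLE (le_sup_left : U ≤ U ⊔ V)
    let b := X.homOfLE (le_sup_right : V ≤ U ⊔ V)
    have hc : a.opensRange ⊔ b.opensRange = ⊤ := by
      rw [eq_top_iff]
      rintro ⟨y, hy⟩ -
      rcases hy with hy | hy
      · exact Or.inl ⟨⟨y, hy⟩, by apply Subtype.ext; simp [a]⟩
      · exact Or.inr ⟨⟨y, hy⟩, by apply Subtype.ext; simp [b]⟩
    have hn : IsNoetherian U := noeth_opens U
    have : CompactSpace ↥(pullback a b) :=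
      QuasiCompact.compactSpace_of_compactSpace (pullback.fst a b)
    refine desc_glue σ _ a b hc (IsPullback.of_hasPullback a b) ?_ ?_
    · rwa [← Category.assoc, Scheme.homOfLE_ι]
    · rwa [← Category.assoc, Scheme.homOfLE_ι]
  have hloc : ∀ y : X, ∃ V : X.Opens, y ∈ V ∧ Desc σ (V.ι ≫ x) := by
    intro y
    obtain ⟨_, ⟨O, hO, rfl⟩, hyO, -⟩ := (σ.D.obj i).isBasis_affineOpens.exists_subset_of_mem_open
      (Set.mem_univ ((x ≫ σ.c.π.app i) y)) isOpen_univ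
    obtain ⟨_, ⟨V, hV, rfl⟩, hyV, hVO⟩ := X.isBasis_affineOpens.exists_subset_of_mem_open
      (a := y) (u := (x ≫ σ.c.π.app i) ⁻¹ᵁ O) hyO ((x ≫ σ.c.π.app i) ⁻¹ᵁ O).2
    have : IsAffine V := hV
    refine ⟨V, hyV, desc_local σ _ i O hO fun a ↦ ?_⟩
    exact hVO a.2
  choose V hV hVd using hloc
  obtain ⟨t, ht⟩ := CompactSpace.elim_nhds_subcover (fun y ↦ (V y : Set X))
    (fun y ↦ (V y).2.mem_nhds (hV y))
  have htop : t.sup V = ⊤ := by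
    rw [eq_top_iff]
    intro y _
    have : y ∈ ⋃ z ∈ t, (V z : Set X) := by rw [ht]; trivial
    simp only [Set.mem_iUnion] at this
    obtain ⟨z, hz, hy⟩ := this
    exact Finset.le_sup (f := V) hz hy
  have hall : Desc σ ((t.sup V).ι ≫ x) :=
    Finset.sup_induction (p := fun U : X.Opens ↦ Desc σ (U.ι ≫ x)) hb (fun U hU V hV ↦ hsup U V hU hV)
      (fun y _ ↦ hVd y)
  rw [htop] at hall
  obtain ⟨j, P, p, h1, h2, g, h⟩ := hall
  refine ⟨j, P, p, h1, h2, X.topIso.inv ≫ g, ?_⟩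
  exact h.of_iso X.topIso (Iso.refl _) (Iso.refl _) (Iso.refl _) (by simp) (by simp) (by simp)
    (by simp)

end CDF

namespace CDF

/-- the base changes of `x` and `y` along `t` are isomorphic -/
def J {X Y S T : Scheme.{u}} (x : X ⟶ S) (y : Y ⟶ S) (t : T ⟶ S) : Prop :=
  ∃ (Q : Scheme.{u}) (q : Q ⟶ T) (u : Q ⟶ X) (u' : Q ⟶ Y), IsPullback u q x t ∧ IsPullback u' q y t

lemma J.of_iso {X Y S T : Scheme.{u}} {x : X ⟶ S} {y : Y ⟶ S} {t : T ⟶ S}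
    (e : pullback x t ≅ pullback y t) (he : e.hom ≫ pullback.snd y t = pullback.snd x t) :
    J x y t := by
  refine ⟨_, _, _, e.hom ≫ pullback.fst y t, IsPullback.of_hasPullback x t, ?_⟩
  exact (IsPullback.of_hasPullback y t).of_iso e.symm (Iso.refl _) (Iso.refl _) (Iso.refl _)
    (by simp) (by simp [← he]) (by simp) (by simp)

lemma J.iso {X Y S T : Scheme.{u}} {x : X ⟶ S} {y : Y ⟶ S} {t : T ⟶ S} (h : J x y t) :
    ∃ e : pullback x t ≅ pullback y t, e.hom ≫ pullback.snd y t = pullback.snd x t := by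
  obtain ⟨Q, q, u, u', h, h'⟩ := h
  refine ⟨h.isoPullback.symm ≪≫ h'.isoPullback, ?_⟩
  simp

lemma J.comp {X Y S T T' : Scheme.{u}} {x : X ⟶ S} {y : Y ⟶ S} {t : T ⟶ S} (h : J x y t)
    (r : T' ⟶ T) : J x y (r ≫ t) := by
  obtain ⟨Q, q, u, u', h, h'⟩ := h
  have S := (IsPullback.of_hasPullback q r)
  exact ⟨_, _, _, _, S.paste_horiz h, S.paste_horiz h'⟩

lemma J.to {X Y S T X₀ Y₀ S₀ : Scheme.{u}} {x : X ⟶ S} {y : Y ⟶ S} {t : T ⟶ S} (h : J x y t)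
    {π : S ⟶ S₀} {x₀ : X₀ ⟶ S₀} {y₀ : Y₀ ⟶ S₀} {g : X ⟶ X₀} {g' : Y ⟶ Y₀}
    (hx : IsPullback g x x₀ π) (hy : IsPullback g' y y₀ π) : J x₀ y₀ (t ≫ π) := by
  obtain ⟨Q, q, u, u', h, h'⟩ := h
  exact ⟨_, _, _, _, h.paste_horiz hx, h'.paste_horiz hy⟩

lemma J.of {X Y S T X₀ Y₀ S₀ : Scheme.{u}} {x : X ⟶ S} {y : Y ⟶ S} {t : T ⟶ S}
    {π : S ⟶ S₀} {x₀ : X₀ ⟶ S₀} {y₀ : Y₀ ⟶ S₀} {g : X ⟶ X₀} {g' : Y ⟶ Y₀}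
    (hx : IsPullback g x x₀ π) (hy : IsPullback g' y y₀ π) (h : J x₀ y₀ (t ≫ π)) : J x y t := by
  obtain ⟨Q, q, u, u', h, h'⟩ := h
  have e : u ≫ x₀ = (q ≫ t) ≫ π := by rw [h.w, Category.assoc]
  have e' : u' ≫ y₀ = (q ≫ t) ≫ π := by rw [h'.w, Category.assoc]
  refine ⟨Q, q, hx.lift _ _ e, hy.lift _ _ e', ?_, ?_⟩
  · refine IsPullback.of_right ?_ (hx.lift_snd _ _ e) hx
    rwa [hx.lift_fst]
  · refine IsPullback.of_right ?_ (hy.lift_snd _ _ e') hy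
    rwa [hy.lift_fst]

lemma J.descend (τ : Sys.{u}) {X₀ Y₀ S₀ : Scheme.{u}} (hS : FTZ S₀) (x₀ : X₀ ⟶ S₀) (y₀ : Y₀ ⟶ S₀)
    [LocallyOfFiniteType x₀] [QuasiCompact x₀] [LocallyOfFiniteType y₀] [QuasiCompact y₀]
    (s : τ.c.pt ⟶ S₀) (h : J x₀ y₀ s) :
    ∃ (j : τ.I) (m : τ.D.obj j ⟶ S₀), τ.c.π.app j ≫ m = s ∧ J x₀ y₀ m := by
  have hl : LocallyOfFiniteType (specULiftZIsTerminal.from S₀) := hS.hom _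
  have : LocallyOfFinitePresentation (specULiftZIsTerminal.from S₀) := FTZ.specZ.lofp _
  obtain ⟨k, m, hm, -⟩ := τ.exists_hom (fun i ↦ specULiftZIsTerminal.from _)
    (fun _ ↦ specULiftZIsTerminal.hom_ext _ _) (specULiftZIsTerminal.from S₀) s
    (fun _ ↦ specULiftZIsTerminal.hom_ext _ _)
  subst hm
  have sx := IsPullback.of_hasPullback x₀ m
  have sy := IsPullback.of_hasPullback y₀ m
  obtain ⟨Q, q, u, u', h, h'⟩ := J.of sx sy h
  obtain ⟨j, f, Q, q, u, u', h1, h2, -⟩ := τ.isoDesc _ _ h h'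
  refine ⟨j, τ.D.map f ≫ m, ?_, J.to ⟨_, _, _, _, h1, h2⟩ sx sy⟩
  rw [← Category.assoc, τ.c.w]

lemma main_aux (B S X Y S₀ X₀ Y₀ : Scheme.{u}) [IsNoetherian B] (hS : FTZ S₀)
    (x : X ⟶ S) (y : Y ⟶ S) (x₀ : X₀ ⟶ S₀) (y₀ : Y₀ ⟶ S₀)
    [LocallyOfFiniteType x₀] [QuasiCompact x₀] [LocallyOfFiniteType y₀] [QuasiCompact y₀]
    {π : S ⟶ S₀} {g : X ⟶ X₀} {g' : Y ⟶ Y₀}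
    (hx : IsPullback g x x₀ π) (hy : IsPullback g' y y₀ π) :
    ∃ (I : Type) (_ : Countable I) (T : I → Scheme.{u}) (t : ∀ i, T i ⟶ S),
      (∀ i, LocallyOfFiniteType (t i) ∧ QuasiCompact (t i)) ∧ (∀ i, J x y (t i)) ∧
      ∀ s : B ⟶ S, J x y s → ∃ (i : I) (r : B ⟶ T i), r ≫ t i = s := by
  obtain ⟨F, hF, hF'⟩ := exists_enum hS
  refine ⟨{n : ℕ // J x₀ y₀ (F n).hom}, inferInstance, fun n ↦ pullback (F n).hom π,
    fun n ↦ pullback.snd (F n).hom π, fun n ↦ ?_, fun n ↦ ?_, fun s hs ↦ ?_⟩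
  · have h1 : LocallyOfFiniteType (F n).hom := (hF n).hom _
    have h2 : QuasiCompact (F n).hom := (hF n).qc _
    exact loft_qc_of_isPullback (IsPullback.of_hasPullback (F n).hom π)
  · refine J.of hx hy ?_
    rw [← pullback.condition]
    exact n.2.comp _
  · obtain ⟨τ, rfl⟩ := exists_sys' B
    obtain ⟨j, m, h1, h2⟩ := J.descend τ hS x₀ y₀ (s ≫ π) (hs.to hx hy)
    obtain ⟨n, ⟨e⟩⟩ := hF' (Over.mk m) (τ.ftz j)
    have en : e.hom.left ≫ m = (F n).hom := Over.w e.hom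
    have em : e.inv.left ≫ (F n).hom = m := Over.w e.inv
    have w : (τ.c.π.app j ≫ e.inv.left) ≫ (F n).hom = s ≫ π := by
      rw [← h1]
      exact (Category.assoc _ _ _).trans (congrArg (τ.c.π.app j ≫ ·) em)
    refine ⟨⟨n, ?_⟩, pullback.lift _ _ w, pullback.lift_snd _ _ w⟩
    rw [← en]
    exact h2.comp _

lemma main_aux2 (B : Scheme.{u}) (σ : Sys.{u}) [IsNoetherian B] [IsNoetherian σ.c.pt]
    {X Y : Scheme.{u}} (x : X ⟶ σ.c.pt) (y : Y ⟶ σ.c.pt)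
    [LocallyOfFiniteType x] [QuasiCompact x] [LocallyOfFiniteType y] [QuasiCompact y] :
    ∃ (I : Type) (_ : Countable I) (T : I → Scheme.{u}) (t : ∀ i, T i ⟶ σ.c.pt),
      (∀ i, LocallyOfFiniteType (t i) ∧ QuasiCompact (t i)) ∧ (∀ i, J x y (t i)) ∧
      ∀ s : B ⟶ σ.c.pt, J x y s → ∃ (i : I) (r : B ⟶ T i), r ≫ t i = s := by
  obtain ⟨i, P, p, _, _, g, h⟩ := desc_all σ x
  obtain ⟨i', P', p', _, _, g', h'⟩ := desc_all σ y
  have S := IsPullback.of_hasPullback p (σ.D.map (IsCofiltered.minToLeft i i'))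
  have S' := IsPullback.of_hasPullback p' (σ.D.map (IsCofiltered.minToRight i i'))
  obtain ⟨w, -, hw⟩ := σ.pull h _ S
  obtain ⟨w', -, hw'⟩ := σ.pull h' _ S'
  exact main_aux B _ X Y _ _ _ (σ.ftz _) x y _ _ hw hw'

end CDF

/-- Let `B` be a noetherian scheme, `S` a finite type `B`-scheme, and `X`, `Y` finite type
`S`-schemes. There exists a countable family `{Sᵢ ⟶ S}` of finite type `S`-schemes such that
(1) for each `i` the base changes `X ×_S Sᵢ` and `Y ×_S Sᵢ` are isomorphic as `Sᵢ`-schemes, and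
(2) every section `s : B ⟶ S` of `S ⟶ B` with `X ×_{S,s} B ≅ Y ×_{S,s} B` as `B`-schemes
factors through one of the morphisms `Sᵢ ⟶ S`. -/
theorem exists_countable_family_detecting_fiber_isomorphisms
    (B S X Y : Scheme) [IsNoetherian B]
    (f : S ⟶ B) [LocallyOfFiniteType f] [QuasiCompact f]
    (x : X ⟶ S) [LocallyOfFiniteType x] [QuasiCompact x]
    (y : Y ⟶ S) [LocallyOfFiniteType y] [QuasiCompact y] :
    ∃ (I : Type) (_ : Countable I) (T : I → Scheme) (t : ∀ i, T i ⟶ S),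
      (∀ i, LocallyOfFiniteType (t i) ∧ QuasiCompact (t i)) ∧
      (∀ i, ∃ e : pullback x (t i) ≅ pullback y (t i),
        e.hom ≫ pullback.snd y (t i) = pullback.snd x (t i)) ∧
      (∀ s : B ⟶ S, s ≫ f = 𝟙 B →
        (∃ e : pullback x s ≅ pullback y s,
          e.hom ≫ pullback.snd y s = pullback.snd x s) →
        ∃ (i : I) (r : B ⟶ T i), r ≫ t i = s) := by
  have : IsLocallyNoetherian S := LocallyOfFiniteType.isLocallyNoetherian f
  have : CompactSpace S := QuasiCompact.compactSpace_of_compactSpace f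
  have hN : IsNoetherian S := {}
  obtain ⟨σ, rfl⟩ := CDF.exists_sys' S
  obtain ⟨I, hI, T, t, h1, h2, h3⟩ := CDF.main_aux2 B σ x y
  exact ⟨I, hI, T, t, h1, fun i ↦ (h2 i).iso, fun s _ ⟨e, he⟩ ↦ h3 s (CDF.J.of_iso e he)⟩
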